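/- Let V₁, …, Vₙ be finitely many closed subsets of ℝ², each homeomorphic to the closed two-dimensional disk, such that the union of their interiors ⋃ᵢ int Vᵢ is connected. Let W be the unbounded connected component of ℝ² \ ⋃ᵢ Vᵢ. Then ℝ² \ W is homeomorphic to the closed two-dimensional disk. -/

import Mathlib

open Metric Set

/-- The plane `ℝ²`. -/
abbrev Plane := EuclideanSpace ℝ (Fin 2)

/-! ### Continuous logarithms and separation in the plane -/

/-- The function `f` admits a continuous logarithm on `s`. -/
def HasLogOn {X : Type*} [TopologicalSpace X] (f : X → ℂ) (s : Set X) : Prop :=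
  ∃ u : X → ℂ, ContinuousOn u s ∧ ∀ z ∈ s, Complex.exp (u z) = f z

theorem HasLogOn.mono {X : Type*} [TopologicalSpace X] {f : X → ℂ} {s t : Set X} (h : HasLogOn f s)
    (hts : t ⊆ s) :
    HasLogOn f t := by
  obtain ⟨u, hu, hf⟩ := h
  exact ⟨u, hu.mono hts, fun z hz => hf z (hts hz)⟩

theorem exists_continuousOn_glue {X Y : Type*} [TopologicalSpace X] [TopologicalSpace Y]
    {A B : Set X} (hA : IsClosed A) (hB : IsClosed B) {u v : X → Y} (hu : ContinuousOn u A)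
    (hv : ContinuousOn v B) (h : ∀ z ∈ A ∩ B, u z = v z) :
    ∃ w : X → Y, ContinuousOn w (A ∪ B) ∧ EqOn w u A ∧ EqOn w v B := by
  classical
  have h1 : EqOn (A.piecewise u v) u A := piecewise_eqOn A u v
  have h2 : EqOn (A.piecewise u v) v B := by
    intro z hz
    by_cases hzA : z ∈ A
    · rw [h1 hzA, h z ⟨hzA, hz⟩]
    · simp [hzA]
  exact ⟨A.piecewise u v, (hu.congr h1).union_of_isClosed (hv.congr h2) hA hB, h1, h2⟩

theorem exists_continuous_eqOn {X : Type*} [TopologicalSpace X] [NormalSpace X] {s : Set X}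
    (hs : IsClosed s) {u : X → ℂ} (hu : ContinuousOn u s) :
    ∃ v : X → ℂ, Continuous v ∧ EqOn v u s := by
  obtain ⟨g, hg⟩ := ContinuousMap.exists_restrict_eq hs
    (⟨s.domRestrict u, continuousOn_iff_continuous_domRestrict.1 hu⟩ : C(s, ℂ))
  exact ⟨g, g.continuous, fun z hz => congrArg (fun k : C(s, ℂ) => k ⟨z, hz⟩) hg⟩

theorem eq_zero_of_exp_eq_one_of_norm_lt {x : ℂ} (h : Complex.exp x = 1) (hx : ‖x‖ < 1) :
    x = 0 := by
  obtain ⟨n, rfl⟩ := Complex.exp_eq_one_iff.1 h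
  have hpi := Real.pi_gt_three
  by_cases hn : n = 0
  · simp [hn]
  · exfalso
    have h1 : (1 : ℝ) ≤ |(n : ℝ)| := by exact_mod_cast Int.one_le_abs hn
    simp only [norm_mul, Complex.norm_intCast, Complex.norm_ofNat, Complex.norm_real,
      Complex.norm_I, Real.norm_eq_abs, abs_of_pos Real.pi_pos] at hx
    nlinarith

/-- Two continuous logarithms of the same function differ by a constant on a preconnected set. -/
theorem IsPreconnected.exists_eq_add_of_exp_eq {X : Type*} [TopologicalSpace X] {Q : Set X}
    (hQ : IsPreconnected Q) {u v : X → ℂ} (hu : ContinuousOn u Q) (hv : ContinuousOn v Q)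
    (h : ∀ z ∈ Q, Complex.exp (u z) = Complex.exp (v z)) :
    ∃ c : ℂ, Complex.exp c = 1 ∧ ∀ z ∈ Q, u z = v z + c := by
  rcases Q.eq_empty_or_nonempty with rfl | ⟨a, ha⟩
  · exact ⟨0, by simp, by simp⟩
  have h1 : ∀ z ∈ Q, Complex.exp (u z - v z) = 1 := fun z hz => by
    rw [Complex.exp_sub, h z hz, div_self (Complex.exp_ne_zero _)]
  refine ⟨u a - v a, h1 a ha, fun z hz => ?_⟩
  have key : u a - v a = u z - v z := by
    refine hQ.induction₂ (fun z w => u z - v z = u w - v w) (fun x hx => ?_)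
      (fun x y z _ _ _ => Eq.trans) (fun x y _ _ => Eq.symm) ha hz
    have hd : ContinuousWithinAt (fun w => u w - v w) Q x := (hu.sub hv) x hx
    filter_upwards [hd.eventually (ball_mem_nhds _ one_pos), self_mem_nhdsWithin] with w hw hwQ
    have := eq_zero_of_exp_eq_one_of_norm_lt (x := (u w - v w) - (u x - v x))
      (by rw [Complex.exp_sub, h1 w hwQ, h1 x hx, div_one]) (by simpa [dist_eq_norm] using hw)
    exact (sub_eq_zero.1 this).symm
  rw [key]; ring

/-- Gluing of logarithms, when they are defined on a preconnected set containing the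
intersection. -/
theorem HasLogOn.union_of_subset {X : Type*} [TopologicalSpace X] {f : X → ℂ}
    {A B A' B' Q : Set X} (hA : HasLogOn f A') (hB : HasLogOn f B') (hAc : IsClosed A)
    (hBc : IsClosed B) (hAA' : A ⊆ A') (hBB' : B ⊆ B')
    (hQ : IsPreconnected Q) (hQA : Q ⊆ A') (hQB : Q ⊆ B') (hABQ : A ∩ B ⊆ Q) :
    HasLogOn f (A ∪ B) := by
  obtain ⟨u, hu, hfu⟩ := hA
  obtain ⟨v, hv, hfv⟩ := hB
  obtain ⟨c, hc, hcQ⟩ := hQ.exists_eq_add_of_exp_eq (hu.mono hQA) (hv.mono hQB)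
    (fun z hz => by rw [hfu z (hQA hz), hfv z (hQB hz)])
  obtain ⟨w, hw, hwA, hwB⟩ := exists_continuousOn_glue hAc hBc (hu.mono hAA')
    ((hv.mono hBB').add (continuousOn_const (c := c))) (fun z hz => hcQ z (hABQ hz))
  refine ⟨w, hw, fun z hz => ?_⟩
  rcases hz with hz | hz
  · rw [hwA hz, hfu z (hAA' hz)]
  · rw [hwB hz, Pi.add_apply, Complex.exp_add, hc, mul_one, hfv z (hBB' hz)]

theorem HasLogOn.union {X : Type*} [TopologicalSpace X] {f : X → ℂ} {A B : Set X}
    (hA : HasLogOn f A) (hB : HasLogOn f B) (hAc : IsClosed A) (hBc : IsClosed B)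
    (hQ : IsPreconnected (A ∩ B)) :
    HasLogOn f (A ∪ B) :=
  hA.union_of_subset hB hAc hBc subset_rfl subset_rfl hQ inter_subset_left inter_subset_right
    subset_rfl

/-- Two points outside a closed set which can be joined by a preconnected set avoiding it have a
quotient with a logarithm. -/
theorem hasLogOn_of_isPreconnected {C S : Set ℂ} (hC : IsClosed C) (hS : IsPreconnected S)
    (hSC : S ⊆ Cᶜ) {x y : ℂ} (hx : x ∈ S) (hy : y ∈ S) :
    HasLogOn (fun z => (z - x) / (z - y)) C := by
  have hne : ∀ x ∈ S, ∀ z ∈ C, z - x ≠ 0 := by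
    rintro x hx z hz h
    rw [sub_eq_zero] at h
    exact hSC hx (h ▸ hz)
  refine hS.induction₂ (fun x y => HasLogOn (fun z => (z - x) / (z - y)) C) ?_ ?_ ?_ hx hy
  · intro x hx
    obtain ⟨r, hr, hball⟩ := Metric.isOpen_iff.1 hC.isOpen_compl x (hSC hx)
    filter_upwards [mem_nhdsWithin_of_mem_nhds (ball_mem_nhds x (half_pos hr)),
      self_mem_nhdsWithin] with y hy hyS
    have hslit : ∀ z ∈ C, (z - x) / (z - y) ∈ Complex.slitPlane := by
      intro z hz
      have h1 : r ≤ dist z x := by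
        by_contra! h
        exact hball h hz
      have h2 : dist y x < r / 2 := hy
      have h3 : r / 2 < dist z y := by
        have := dist_triangle z y x
        linarith
      have h4 : (z - x) / (z - y) = 1 + (y - x) / (z - y) := by
        field_simp [hne y hyS z hz]
        ring
      rw [h4]
      apply Complex.mem_slitPlane_of_norm_lt_one
      rw [norm_div, ← dist_eq_norm, ← dist_eq_norm, div_lt_one (by linarith)]
      linarith
    refine ⟨fun z => Complex.log ((z - x) / (z - y)), ?_, ?_⟩
    · refine ContinuousOn.clog ?_ hslit
      exact (continuousOn_id.sub continuousOn_const).div (continuousOn_id.sub continuousOn_const)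
        (hne y hyS)
    · intro z hz
      exact Complex.exp_log (div_ne_zero (hne x hx z hz) (hne y hyS z hz))
  · rintro x y w hx hy hw ⟨u, hu, hfu⟩ ⟨v, hv, hfv⟩
    refine ⟨u + v, hu.add hv, fun z hz => ?_⟩
    rw [Pi.add_apply, Complex.exp_add, hfu z hz, hfv z hz]
    field_simp [hne x hx z hz, hne y hy z hz, hne w hw z hz]
  · rintro x y hx hy ⟨u, hu, hfu⟩
    refine ⟨-u, hu.neg, fun z hz => ?_⟩
    rw [Pi.neg_apply, Complex.exp_neg, hfu z hz, inv_div]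

theorem exists_log_of_continuous {F : ℂ → ℂ} (hF : Continuous F) (h0 : ∀ z, F z ≠ 0) :
    ∃ u : ℂ → ℂ, Continuous u ∧ ∀ z, Complex.exp (u z) = F z := by
  have hs : IsSimplyConnected (univ : Set ℂ) := by
    have : ContractibleSpace (univ : Set ℂ) :=
      (Homeomorph.Set.univ ℂ).contractibleSpace
    exact (inferInstance : SimplyConnectedSpace (univ : Set ℂ))
  obtain ⟨f, hf, hfe⟩ := Complex.exists_continuousOn_eqOn_exp_comp hs isOpen_univ
    hF.continuousOn (by rintro ⟨z, -, hz⟩; exact h0 z hz)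
  exact ⟨f, continuousOn_univ.1 hf, fun z => hfe (mem_univ z)⟩

/-- The identity of a circle does not extend to a nonvanishing function on the plane. -/
theorem exists_eq_zero_of_eq_sub_on_sphere {F : ℂ → ℂ} (hF : Continuous F) {x : ℂ} {R : ℝ}
    (hR : 0 < R) (h : ∀ z ∈ sphere x R, F z = z - x) : ∃ z, F z = 0 := by
  by_contra! h0
  obtain ⟨u, hu, hue⟩ := exists_log_of_continuous hF h0
  let v : ℝ → ℂ := fun θ => u (x + R * Complex.exp (θ * Complex.I))
  let w : ℝ → ℂ := fun θ => Real.log R + θ * Complex.I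
  have hv : Continuous v := by fun_prop
  have hw : Continuous w := by fun_prop
  obtain ⟨c, -, hc⟩ := isPreconnected_univ.exists_eq_add_of_exp_eq (u := v) (v := w)
    hv.continuousOn hw.continuousOn (by
      intro θ _
      simp only [v, w]
      rw [hue, h _ (by simp [Complex.norm_exp_ofReal_mul_I, abs_of_pos hR]),
        Complex.exp_add, ← Complex.ofReal_exp, Real.exp_log hR]
      ring)
  have h1 := hc 0 trivial
  have h2 := hc (2 * Real.pi) trivial
  have h3 : v (2 * Real.pi) = v 0 := by
    simp only [v]
    push_cast
    rw [Complex.exp_two_pi_mul_I]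
    simp
  rw [h3, h1] at h2
  simp only [w] at h2
  have := congrArg Complex.im h2
  simp at this

theorem IsPreconnected.exists_mem_closure_diff {X : Type*} [TopologicalSpace X] {S C : Set X}
    (hS : IsPreconnected S) (hC : IsOpen C) (h1 : (S ∩ C).Nonempty) (h2 : ¬ S ⊆ C) :
    ∃ p ∈ S, p ∈ closure C ∧ p ∉ C := by
  by_contra! h
  obtain ⟨y, hyS, hyC⟩ := not_subset.1 h2
  obtain ⟨z, -, hz⟩ := hS C (closure C)ᶜ hC isClosed_closure.isOpen_compl
    (fun p hp => by
      by_cases hpc : p ∈ closure C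
      · exact Or.inl (h p hp hpc)
      · exact Or.inr hpc)
    h1 ⟨y, hyS, fun hy => hyC (h y hyS hy)⟩
  exact hz.2 (subset_closure hz.1)

theorem closure_connectedComponentIn_inter_subset {X : Type*} [TopologicalSpace X] {F : Set X}
    {x : X} : closure (connectedComponentIn F x) ∩ F ⊆ connectedComponentIn F x := by
  rintro p ⟨hp, hpF⟩
  by_cases hx : x ∈ F
  · have hpre : IsPreconnected (insert p (connectedComponentIn F x)) :=
      isPreconnected_connectedComponentIn.subset_closure (subset_insert _ _)
        (insert_subset hp subset_closure)
    exact hpre.subset_connectedComponentIn (mem_insert_of_mem _ (mem_connectedComponentIn hx))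
      (insert_subset hpF (connectedComponentIn_subset F x)) (mem_insert _ _)
  · simp [connectedComponentIn_eq_empty hx] at hp

/-- Eilenberg's criterion: if the quotient has a logarithm on a closed set whose complement is
bounded, then the two points are not separated. -/
theorem HasLogOn.mem_connectedComponentIn {C : Set ℂ} {x y : ℂ} (hC : IsClosed C)
    (hx : x ∉ C) (hy : y ∉ C) (hb : Bornology.IsBounded (connectedComponentIn Cᶜ x))
    (h : HasLogOn (fun z => (z - x) / (z - y)) C) : y ∈ connectedComponentIn Cᶜ x := by
  by_contra hyO
  set O := connectedComponentIn Cᶜ x with hO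
  have hOo : IsOpen O := hC.isOpen_compl.connectedComponentIn
  have hxO : x ∈ O := _root_.mem_connectedComponentIn hx
  have hfr : closure O ∩ Oᶜ ⊆ C := by
    rintro p ⟨hp, hpO⟩
    by_contra hpC
    exact hpO (closure_connectedComponentIn_inter_subset ⟨hp, hpC⟩)
  obtain ⟨u, hu, hfu⟩ := h
  obtain ⟨v, hv, hvu⟩ := exists_continuous_eqOn (isClosed_closure.inter hOo.isClosed_compl)
    (hu.mono hfr)
  obtain ⟨F, hF, hF1, hF2⟩ := exists_continuousOn_glue (A := closure O) (B := Oᶜ)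
    (u := fun z => (z - y) * Complex.exp (v z)) (v := fun z => z - x) isClosed_closure
    hOo.isClosed_compl (by fun_prop) (by fun_prop) (by
      intro z hz
      have hzy : z - y ≠ 0 := by
        rw [sub_ne_zero]
        rintro rfl
        exact hy (hfr hz)
      rw [hvu hz, hfu z (hfr hz)]
      field_simp)
  have hFc : Continuous F := by
    rw [← continuousOn_univ]
    convert hF
    rw [eq_comm, eq_univ_iff_forall]
    intro z
    by_cases hz : z ∈ O
    · exact Or.inl (subset_closure hz)
    · exact Or.inr hz
  obtain ⟨R, hR, hOR⟩ := hb.subset_ball_lt 0 x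
  obtain ⟨z, hz⟩ := exists_eq_zero_of_eq_sub_on_sphere hFc hR (fun z hz => by
    rw [hF2]
    intro hzO
    have := hOR hzO
    rw [mem_ball] at this
    rw [mem_sphere] at hz
    linarith)
  by_cases hzO : z ∈ closure O
  · rw [hF1 hzO] at hz
    have : z = y := by simpa [Complex.exp_ne_zero, sub_eq_zero] using hz
    subst this
    by_cases h : z ∈ O
    · exact hyO h
    · exact hy (hfr ⟨hzO, h⟩)
  · have h : z ∈ Oᶜ := fun h => hzO (subset_closure h)
    rw [hF2 h, sub_eq_zero] at hz
    exact h (hz ▸ hxO)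

/-! ### Topological disks -/

/-- A homeomorphism between `V` and the closed unit disk, given by globally defined maps. -/
structure DiskParam (V : Set ℂ) (H G : ℂ → ℂ) : Prop where
  continuous_toFun : Continuous H
  continuous_invFun : Continuous G
  mem : ∀ z, H z ∈ V
  norm_le : ∀ w ∈ V, ‖G w‖ ≤ 1
  left_inv : ∀ z, ‖z‖ ≤ 1 → G (H z) = z
  right_inv : ∀ w ∈ V, H (G w) = w

theorem exists_retraction_closedBall {E : Type*} [NormedAddCommGroup E] [NormedSpace ℝ E] :
    ∃ ρ : E → E, Continuous ρ ∧ (∀ z, ‖ρ z‖ ≤ 1) ∧ ∀ z, ‖z‖ ≤ 1 → ρ z = z := by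
  have hpos : ∀ z : E, 0 < max 1 ‖z‖ := fun z => lt_max_of_lt_left one_pos
  refine ⟨fun z => (max 1 ‖z‖)⁻¹ • z, ?_, fun z => ?_, fun z hz => ?_⟩
  · exact ((continuous_const.max continuous_norm).inv₀ (fun z => (hpos z).ne')).smul continuous_id
  · rw [norm_smul, norm_inv, Real.norm_of_nonneg (hpos z).le, inv_mul_le_iff₀ (hpos z), mul_one]
    exact le_max_right _ _
  · simp [max_eq_left hz]

theorem exists_diskParam {V : Set ℂ} (hV : IsClosed V) (e : V ≃ₜ closedBall (0 : ℂ) 1) :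
    ∃ H G, DiskParam V H G := by
  obtain ⟨ρ, hρ, hρ1, hρ2⟩ := exists_retraction_closedBall (E := ℂ)
  have hmem : ∀ z, ρ z ∈ closedBall (0 : ℂ) 1 := fun z => by simpa using hρ1 z
  classical
  let g : ℂ → ℂ := fun w => if h : w ∈ V then (e ⟨w, h⟩ : ℂ) else 0
  have hg : ∀ w (h : w ∈ V), g w = e ⟨w, h⟩ := fun w h => dif_pos h
  have hgV : ContinuousOn g V := by
    rw [continuousOn_iff_continuous_domRestrict]
    have : V.domRestrict g = fun w => (e w : ℂ) := by
      funext w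
      exact hg w w.2
    rw [this]
    fun_prop
  obtain ⟨G, hG, hGg⟩ := exists_continuous_eqOn hV hgV
  refine ⟨fun z => e.symm ⟨ρ z, hmem z⟩, G, ?_, hG, fun z => Subtype.coe_prop _, fun w hw => ?_,
    fun z hz => ?_, fun w hw => ?_⟩
  · have : Continuous fun z => (⟨ρ z, hmem z⟩ : closedBall (0 : ℂ) 1) := hρ.subtype_mk _
    fun_prop
  · rw [hGg hw, hg w hw]
    exact mem_closedBall_zero_iff.1 (e ⟨w, hw⟩).2
  · rw [hGg (Subtype.coe_prop _), hg _ (Subtype.coe_prop _)]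
    simp [hρ2 z hz]
  · have h1 : ‖g w‖ ≤ 1 := by
      rw [hg w hw]
      exact mem_closedBall_zero_iff.1 (e ⟨w, hw⟩).2
    have h2 : (⟨ρ (G w), hmem (G w)⟩ : closedBall (0 : ℂ) 1) = e ⟨w, hw⟩ := by
      ext
      simp only
      rw [hGg hw, hρ2 _ h1, hg w hw]
    simp [h2]

theorem DiskParam.image_closedBall {V : Set ℂ} {H G : ℂ → ℂ} (h : DiskParam V H G) :
    H '' closedBall 0 1 = V := by
  refine Subset.antisymm (image_subset_iff.2 fun z _ => h.mem z) fun w hw => ?_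
  exact ⟨G w, by simpa using h.norm_le w hw, h.right_inv w hw⟩

theorem DiskParam.isCompact {V : Set ℂ} {H G : ℂ → ℂ} (h : DiskParam V H G) : IsCompact V := by
  rw [← h.image_closedBall]
  exact (isCompact_closedBall 0 1).image h.continuous_toFun

theorem DiskParam.hasLogOn {V : Set ℂ} {H G : ℂ → ℂ} (h : DiskParam V H G) {f : ℂ → ℂ}
    (hf : ContinuousOn f V) (h0 : ∀ z ∈ V, f z ≠ 0) : HasLogOn f V := by
  obtain ⟨u, hu, hue⟩ := exists_log_of_continuous (hf.comp_continuous h.continuous_toFun h.mem)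
    (fun z => h0 _ (h.mem z))
  exact ⟨u ∘ G, (hu.comp h.continuous_invFun).continuousOn, fun w hw => by
    simp [hue, h.right_inv w hw]⟩

theorem hasLogOn_closedBall {c : ℂ} {r : ℝ} (hr : 0 < r) {f : ℂ → ℂ}
    (hf : ContinuousOn f (closedBall c r)) (h0 : ∀ z ∈ closedBall c r, f z ≠ 0) :
    HasLogOn f (closedBall c r) := by
  obtain ⟨ρ, hρ, hρ1, hρ2⟩ := exists_retraction_closedBall (E := ℂ)
  have hrC : (r : ℂ) ≠ 0 := by exact_mod_cast hr.ne'
  refine DiskParam.hasLogOn (H := fun z => c + r * ρ z) (G := fun w => (w - c) / r)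
    ⟨by fun_prop, by fun_prop, fun z => ?_, fun w hw => ?_, fun z hz => ?_, fun w hw => ?_⟩ hf h0
  · simpa [abs_of_pos hr] using mul_le_of_le_one_right hr.le (hρ1 z)
  · rw [mem_closedBall_iff_norm] at hw
    simp only [norm_div, Complex.norm_real, Real.norm_of_nonneg hr.le]
    exact div_le_one_of_le₀ hw hr.le
  · rw [hρ2 z hz]
    field_simp
    ring
  · have h1 : ‖(w - c) / r‖ ≤ 1 := by
      rw [mem_closedBall_iff_norm] at hw
      simp only [norm_div, Complex.norm_real, Real.norm_of_nonneg hr.le]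
      exact div_le_one_of_le₀ hw hr.le
    rw [hρ2 _ h1]
    field_simp
    ring

/-- A nonvanishing function on a closed subset of the line has a logarithm. -/
theorem hasLogOn_inter_uIcc {F : Set ℝ} (hF : IsClosed F) {f : ℝ → ℂ} (hf : ContinuousOn f F)
    (h0 : ∀ t ∈ F, f t ≠ 0) (a b : ℝ) : HasLogOn f (F ∩ uIcc a b) := by
  refine isPreconnected_univ.induction₂ (fun a b => HasLogOn f (F ∩ uIcc a b)) ?_ ?_ ?_
    (mem_univ a) (mem_univ b)
  · intro a _
    rw [nhdsWithin_univ]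
    by_cases ha : a ∈ F
    · have hs : ∀ᶠ t in nhdsWithin a F, f t / f a ∈ Complex.slitPlane := by
        refine ((hf a ha).div_const (f a)).eventually
          (Complex.isOpen_slitPlane.mem_nhds ?_)
        simp [div_self (h0 a ha)]
      obtain ⟨ε, hε, hball⟩ := Metric.mem_nhdsWithin_iff.1 hs
      filter_upwards [ball_mem_nhds a hε] with b hb
      have hsub : ∀ t ∈ F ∩ uIcc a b, f t / f a ∈ Complex.slitPlane := fun t ht =>
        hball ⟨(convex_ball a ε).ordConnected.uIcc_subset (mem_ball_self hε) hb ht.2, ht.1⟩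
      refine ⟨fun t => Complex.log (f t / f a) + Complex.log (f a), ?_, fun t ht => ?_⟩
      · exact (((hf.mono inter_subset_left).div_const _).clog hsub).add continuousOn_const
      · rw [Complex.exp_add, Complex.exp_log (h0 a ha),
          Complex.exp_log (div_ne_zero (h0 t ht.1) (h0 a ha)), div_mul_cancel₀ _ (h0 a ha)]
    · obtain ⟨ε, hε, hball⟩ := Metric.isOpen_iff.1 hF.isOpen_compl a ha
      filter_upwards [ball_mem_nhds a hε] with b hb
      have hsub : F ∩ uIcc a b = ∅ := by
        rw [eq_empty_iff_forall_notMem]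
        exact fun t ht => hball
          ((convex_ball a ε).ordConnected.uIcc_subset (mem_ball_self hε) hb ht.2) ht.1
      rw [hsub]
      exact ⟨0, continuousOn_empty _, by simp⟩
  · intro a b c _ _ _ hab hbc
    by_cases hb : b ∈ uIcc a c
    · have h_int : uIcc a b ∩ uIcc b c ⊆ {b} := by
        intro t ht
        simp only [mem_inter_iff, mem_uIcc, mem_singleton_iff] at *
        grind
      have := hab.union hbc (hF.inter isClosed_Icc) (hF.inter isClosed_Icc)
        (Set.Subsingleton.isPreconnected (subsingleton_singleton.anti
          ((inter_subset_inter inter_subset_right inter_subset_right).trans h_int)))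
      rw [← inter_union_distrib_left] at this
      exact this.mono (inter_subset_inter_right _ uIcc_subset_uIcc_union_uIcc)
    · have : uIcc a c ⊆ uIcc a b ∨ uIcc a c ⊆ uIcc b c := by
        simp only [uIcc_subset_uIcc_iff_le, mem_uIcc, not_or, not_and_or, not_le] at *
        grind
      rcases this with h | h
      · exact hab.mono (inter_subset_inter_right _ h)
      · exact hbc.mono (inter_subset_inter_right _ h)
  · intro a b _ _ h
    rwa [uIcc_comm]

theorem hasLogOn_of_subset_sphere {c m : ℂ} {δ : ℝ} (hδ : 0 < δ) {F : Set ℂ} (hF : IsClosed F)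
    (hFs : F ⊆ sphere c δ) (hm : m ∈ sphere c δ) (hmF : m ∉ F) {f : ℂ → ℂ}
    (hf : ContinuousOn f F) (h0 : ∀ z ∈ F, f z ≠ 0) : HasLogOn f F := by
  have hmc : m - c ≠ 0 := by
    rw [← norm_pos_iff, ← dist_eq_norm, mem_sphere.1 hm]
    exact hδ
  let e : ℝ → ℂ := fun t => c - (m - c) * Complex.exp (t * Complex.I)
  have he : Continuous e := by fun_prop
  let a : ℂ → ℝ := fun z => Complex.arg (-((z - c) / (m - c)))
  have hnorm : ∀ z ∈ F, ‖-((z - c) / (m - c))‖ = 1 := fun z hz => by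
    rw [norm_neg, norm_div, ← dist_eq_norm, ← dist_eq_norm, mem_sphere.1 hm,
      mem_sphere.1 (hFs hz), div_self hδ.ne']
  have hea : ∀ z ∈ F, e (a z) = z := by
    intro z hz
    have h1 := Complex.norm_mul_exp_arg_mul_I (-((z - c) / (m - c)))
    rw [hnorm z hz, Complex.ofReal_one, one_mul] at h1
    simp only [e, a]
    rw [h1]
    field_simp
    ring
  have ha : ContinuousOn a F := by
    intro z hz
    have hslit : -((z - c) / (m - c)) ∈ Complex.slitPlane := by
      rw [Complex.mem_slitPlane_iff_arg]
      refine ⟨fun harg => hmF ?_, fun h => ?_⟩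
      · have h1 := hea z hz
        simp only [e, a] at h1
        rw [harg, Complex.exp_pi_mul_I] at h1
        have : z = m := by rw [← h1]; ring
        exact this ▸ hz
      · have := hnorm z hz
        rw [h, norm_zero] at this
        exact zero_ne_one this
    have h2 : ContinuousAt (fun z => -((z - c) / (m - c))) z := by fun_prop
    exact ((Complex.continuousAt_arg hslit).comp (f := fun z => -((z - c) / (m - c)))
      h2).continuousWithinAt
  obtain ⟨v, hv, hve⟩ := hasLogOn_inter_uIcc (hF.preimage he) (f := f ∘ e)
    (hf.comp he.continuousOn fun t ht => ht) (fun t ht => h0 _ ht) (-Real.pi) Real.pi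
  have hmaps : MapsTo a F (e ⁻¹' F ∩ uIcc (-Real.pi) Real.pi) := fun z hz => by
    refine ⟨by rwa [mem_preimage, hea z hz], ?_⟩
    rw [uIcc_of_le (by linarith [Real.pi_pos])]
    exact ⟨(Complex.neg_pi_lt_arg _).le, Complex.arg_le_pi _⟩
  exact ⟨v ∘ a, hv.comp ha hmaps, fun z hz => by
    rw [Function.comp_apply, hve _ (hmaps hz), Function.comp_apply, hea z hz]⟩

/-- Invariance of domain for a closed disk. -/
theorem DiskParam.mem_interior {V : Set ℂ} {H G : ℂ → ℂ} (h : DiskParam V H G) {ζ : ℂ}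
    (hζ : ‖ζ‖ < 1) : H ζ ∈ interior V := by
  by_contra hp
  have hVc : IsClosed V := h.isCompact.isClosed
  have hC : IsCompact (H '' sphere 0 1) := (isCompact_sphere 0 1).image h.continuous_toFun
  have hpC : H ζ ∉ H '' sphere 0 1 := by
    rintro ⟨z, hz, hzζ⟩
    have hz1 : ‖z‖ = 1 := by simpa using hz
    have := congrArg G hzζ
    rw [h.left_inv z hz1.le, h.left_inv ζ hζ.le] at this
    rw [this] at hz1
    exact hζ.ne hz1
  obtain ⟨η, hη, hball⟩ := Metric.isOpen_iff.1 hC.isClosed.isOpen_compl _ hpC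
  obtain ⟨c, hcV, hcp⟩ : ∃ c ∉ V, dist c (H ζ) < η / 3 := by
    by_contra! hcon
    refine hp (mem_interior_iff_mem_nhds.2 (Filter.mem_of_superset
      (ball_mem_nhds (H ζ) (show 0 < η / 3 by positivity)) fun c hc => ?_))
    by_contra hcV
    exact absurd hc (not_lt.2 (hcon c hcV))
  set δ := η / 3 with hδdef
  have hδ : 0 < δ := by positivity
  have hCc : ∀ w ∈ H '' sphere 0 1, δ ≤ dist w c := by
    intro w hw
    have h1 : η ≤ dist w (H ζ) := by
      by_contra! hlt
      exact hball hlt hw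
    have := dist_triangle w c (H ζ)
    linarith
  have hG0 : ∀ w ∈ V, w ≠ H ζ → G w - ζ ≠ 0 := by
    intro w hw hne h0
    rw [sub_eq_zero] at h0
    exact hne (by rw [← h0, h.right_inv w hw])
  have hne : ∀ w, δ ≤ dist w c → w ≠ H ζ := by
    rintro w hw rfl
    rw [dist_comm] at hw
    linarith
  obtain ⟨g, hg, hgV, hg0⟩ : ∃ g : ℂ → ℂ, ContinuousOn g (sphere c δ ∪ V ∩ (ball c δ)ᶜ) ∧
      (∀ w ∈ V ∩ (ball c δ)ᶜ, g w = G w - ζ) ∧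
      ∀ w ∈ sphere c δ ∪ V ∩ (ball c δ)ᶜ, g w ≠ 0 := by
    have hd : ∀ w ∈ sphere c δ ∪ V ∩ (ball c δ)ᶜ, δ ≤ dist w c := by
      rintro w (hw | hw)
      · exact (mem_sphere.1 hw).ge
      · simpa using hw.2
    have hGc : Continuous fun w => G w - ζ := h.continuous_invFun.sub continuous_const
    by_cases hsub : sphere c δ ⊆ V
    · refine ⟨fun w => G w - ζ, hGc.continuousOn, fun w _ => rfl, fun w hw =>
        hG0 w ?_ (hne w (hd w hw))⟩
      exact hw.elim (fun h => hsub h) (fun h => h.1)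
    · obtain ⟨m, hm, hmV⟩ := not_subset.1 hsub
      have hFc : IsClosed (sphere c δ ∩ V) := isClosed_sphere.inter hVc
      obtain ⟨u, hu, hue⟩ := hasLogOn_of_subset_sphere hδ hFc
        inter_subset_left hm (fun h => hmV h.2) (f := fun w => G w - ζ) hGc.continuousOn
        (fun w hw => hG0 w hw.2 (hne w (mem_sphere.1 hw.1).ge))
      obtain ⟨v, hv, hvu⟩ := exists_continuous_eqOn hFc hu
      obtain ⟨g, hg, hg1, hg2⟩ := exists_continuousOn_glue (A := sphere c δ)
        (B := V ∩ (ball c δ)ᶜ) (u := fun w => Complex.exp (v w)) (v := fun w => G w - ζ)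
        isClosed_sphere (hVc.inter isOpen_ball.isClosed_compl) (by fun_prop) hGc.continuousOn
        (fun w hw => by rw [hvu ⟨hw.1, hw.2.1⟩, hue w ⟨hw.1, hw.2.1⟩])
      refine ⟨g, hg, hg2, ?_⟩
      rintro w (hw | hw)
      · rw [hg1 hw]
        exact Complex.exp_ne_zero _
      · rw [hg2 hw]
        exact hG0 w hw.1 (hne w (hd w (Or.inr hw)))
  let Φ : ℂ → ℂ := fun w => c + (max 1 (δ / ‖w - c‖) : ℝ) * (w - c)
  have hΦ1 : ∀ w, δ ≤ dist w c → Φ w = w := by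
    intro w hw
    rw [dist_eq_norm] at hw
    have : δ / ‖w - c‖ ≤ 1 := div_le_one_of_le₀ hw (norm_nonneg _)
    simp [Φ, max_eq_left this]
  have hwc : ∀ w ∈ V, w - c ≠ 0 := by
    intro w hw h0
    rw [sub_eq_zero] at h0
    exact hcV (h0 ▸ hw)
  have hΦ2 : MapsTo Φ V (sphere c δ ∪ V ∩ (ball c δ)ᶜ) := by
    intro w hw
    by_cases hd : δ ≤ dist w c
    · rw [hΦ1 w hd]
      exact Or.inr ⟨hw, by simpa using hd⟩
    · left
      rw [not_le, dist_eq_norm] at hd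
      have hpos : 0 < ‖w - c‖ := norm_pos_iff.2 (hwc w hw)
      have : 1 ≤ δ / ‖w - c‖ := (one_le_div hpos).2 hd.le
      rw [mem_sphere_iff_norm]
      simp only [Φ, max_eq_right this, add_sub_cancel_left]
      rw [norm_mul, Complex.norm_real, Real.norm_of_nonneg (by positivity),
        div_mul_cancel₀ _ hpos.ne']
  have hΦ3 : ContinuousOn Φ V := by
    refine continuousOn_const.add (ContinuousOn.mul ?_ (by fun_prop))
    refine Complex.continuous_ofReal.comp_continuousOn ?_
    refine ContinuousOn.sup continuousOn_const (continuousOn_const.div (by fun_prop) fun w hw => ?_)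
    exact norm_ne_zero_iff.2 (hwc w hw)
  obtain ⟨F, hF, hF1, hF2⟩ := exists_continuousOn_glue (A := closedBall (0 : ℂ) 1)
    (B := (ball (0 : ℂ) 1)ᶜ) (u := fun z => g (Φ (H z))) (v := fun z => z - ζ)
    isClosed_closedBall isOpen_ball.isClosed_compl
    ((hg.comp hΦ3 hΦ2).comp h.continuous_toFun.continuousOn fun z _ => h.mem z) (by fun_prop)
    (by
      rintro z ⟨hz1, hz2⟩
      have hz : ‖z‖ = 1 := by
        simp only [mem_closedBall, dist_zero_right, mem_compl_iff, mem_ball, not_lt] at hz1 hz2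
        exact le_antisymm hz1 hz2
      have hd := hCc (H z) (mem_image_of_mem _ (by simpa using hz))
      rw [hΦ1 _ hd, hgV _ ⟨h.mem z, by simpa using hd⟩, h.left_inv z hz.le])
  have hcover : closedBall (0 : ℂ) 1 ∪ (ball (0 : ℂ) 1)ᶜ = univ := by
    rw [eq_univ_iff_forall]
    intro z
    by_cases hz : z ∈ ball (0 : ℂ) 1
    · exact Or.inl (ball_subset_closedBall hz)
    · exact Or.inr hz
  rw [hcover, continuousOn_univ] at hF
  obtain ⟨z, hz⟩ := exists_eq_zero_of_eq_sub_on_sphere hF (x := ζ) (R := 3) (by norm_num) (by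
    intro z hz
    refine hF2 ?_
    rw [mem_sphere_iff_norm] at hz
    have := norm_sub_le z ζ
    simp only [mem_compl_iff, mem_ball, dist_zero_right, not_lt]
    linarith)
  by_cases hz1 : z ∈ closedBall (0 : ℂ) 1
  · rw [hF1 hz1] at hz
    exact hg0 _ (hΦ2 (h.mem z)) hz
  · have hz2 : z ∈ (ball (0 : ℂ) 1)ᶜ := fun h => hz1 (ball_subset_closedBall h)
    rw [hF2 hz2, sub_eq_zero] at hz
    rw [hz] at hz2
    simp at hz2
    linarith

theorem DiskParam.subset_closure_interior {V : Set ℂ} {H G : ℂ → ℂ} (h : DiskParam V H G) :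
    V ⊆ closure (interior V) := by
  rw [← h.image_closedBall, ← closure_ball (0 : ℂ) one_ne_zero]
  refine (image_closure_subset_closure_image h.continuous_toFun).trans (closure_mono ?_)
  rintro _ ⟨z, hz, rfl⟩
  rw [closure_ball (0 : ℂ) one_ne_zero, h.image_closedBall]
  exact h.mem_interior (by simpa using hz)

theorem DiskParam.nonempty_interior {V : Set ℂ} {H G : ℂ → ℂ} (h : DiskParam V H G) :
    (interior V).Nonempty :=
  ⟨_, h.mem_interior (ζ := 0) (by simp)⟩

theorem starConvex_closedBall_diff_ball {ζ : ℂ} (hζ : ‖ζ‖ = 1) (r : ℝ) :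
    StarConvex ℝ (-ζ) (closedBall 0 1 \ ball ζ r) := by
  intro w hw a b ha hb hab
  refine ⟨convex_closedBall (0 : ℂ) 1 (by simp [hζ]) hw.1 ha hb hab, ?_⟩
  obtain ⟨hw1, hw2⟩ := hw
  rw [mem_closedBall_zero_iff] at hw1
  rw [mem_ball_iff_norm, not_lt] at hw2 ⊢
  by_cases hr0 : r < 0
  · exact hr0.le.trans (norm_nonneg _)
  rw [not_lt] at hr0
  have hwζ : ‖w - ζ‖ ≤ 2 := by
    have := norm_sub_le w ζ
    linarith
  suffices ‖w - ζ‖ ≤ ‖a • -ζ + b • w - ζ‖ from hw2.trans this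
  have hd : a • -ζ + b • w - ζ = (-(2 * a) : ℝ) • ζ + b • (w - ζ) := by
    have : a = 1 - b := by linarith
    subst this
    simp only [Complex.real_smul]
    push_cast
    ring
  rw [hd]
  apply le_of_sq_le_sq _ (norm_nonneg _)
  have e1 := norm_sub_sq_real w ζ
  have e2 := norm_add_sq_real ((-(2 * a) : ℝ) • ζ) (b • (w - ζ))
  rw [inner_smul_left, inner_smul_right, inner_sub_right, real_inner_self_eq_norm_sq, norm_smul,
    norm_smul, hζ, real_inner_comm] at e2
  simp only [Real.norm_eq_abs, mul_pow, sq_abs, conj_trivial] at e2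
  rw [hζ] at e1
  have h1 : ‖w‖ ^ 2 ≤ 1 := pow_le_one₀ (norm_nonneg _) hw1
  have h2 : ‖w - ζ‖ ^ 2 ≤ 4 := by nlinarith [norm_nonneg (w - ζ)]
  have hb' : b = 1 - a := by linarith
  subst hb'
  nlinarith [mul_nonneg ha hb, mul_nonneg (mul_nonneg ha hb) (sub_nonneg.2 h1),
    mul_nonneg (mul_nonneg ha ha) (sub_nonneg.2 h2)]

/-- Near a point which is not interior, a disk can be cut off leaving a connected set. -/
theorem DiskParam.exists_isPreconnected_diff_ball {V : Set ℂ} {H G : ℂ → ℂ}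
    (h : DiskParam V H G) {p : ℂ} (hp : p ∉ interior V) {ε : ℝ} (hε : 0 < ε) :
    ∃ Q, IsPreconnected Q ∧ IsClosed Q ∧ V \ ball p ε ⊆ Q ∧ Q ⊆ V ∧ p ∉ Q := by
  by_cases hpV : p ∈ V
  · have hG : ‖G p‖ = 1 := by
      refine (h.norm_le p hpV).eq_of_not_lt fun hlt => hp ?_
      rw [← h.right_inv p hpV]
      exact h.mem_interior hlt
    have hcont := h.continuous_toFun.continuousAt (x := G p)
    rw [Metric.continuousAt_iff, h.right_inv p hpV] at hcont
    obtain ⟨δ, hδ, hball⟩ := hcont ε hε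
    have hpos : 0 < min δ 2 := lt_min hδ two_pos
    refine ⟨H '' (closedBall 0 1 \ ball (G p) (min δ 2)), ?_, ?_, ?_, ?_, ?_⟩
    · have hne : -G p ∈ closedBall (0 : ℂ) 1 \ ball (G p) (min δ 2) := by
        refine ⟨by simp [hG], ?_⟩
        rw [mem_ball_iff_norm, show -G p - G p = -(2 * G p) by ring, norm_neg, norm_mul, hG]
        simp
      exact (((starConvex_closedBall_diff_ball hG _).isPathConnected
        hne).isConnected.isPreconnected).image H h.continuous_toFun.continuousOn
    · exact (((isCompact_closedBall (0 : ℂ) 1).diff isOpen_ball).image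
        h.continuous_toFun).isClosed
    · rintro w ⟨hw, hwp⟩
      refine ⟨G w, ⟨by simpa using h.norm_le w hw, fun hlt => hwp ?_⟩, h.right_inv w hw⟩
      have := hball (lt_of_lt_of_le (mem_ball.1 hlt) (min_le_left _ _))
      rwa [h.right_inv w hw] at this
    · exact image_subset_iff.2 fun z _ => h.mem z
    · rintro ⟨z, ⟨hz1, hz2⟩, hz⟩
      have : z = G p := by rw [← hz, h.left_inv z (by simpa using hz1)]
      exact hz2 (by rw [this]; exact mem_ball_self hpos)
  · refine ⟨V, ?_, h.isCompact.isClosed, sdiff_subset, subset_rfl, hpV⟩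
    rw [← h.image_closedBall]
    exact (convex_closedBall (0 : ℂ) 1).isPreconnected.image H h.continuous_toFun.continuousOn

/-! ### Unions of disks -/

/-- Local connectedness of the complement of a closed set, relative to points of the complement
that the set does not separate. -/
theorem HasLogOn.mem_connectedComponentIn_inter_ball {U Q : Set ℂ} {p x y : ℂ} {δ ε : ℝ}
    (hU : IsClosed U) (hQ : IsPreconnected Q) (hUQ : U \ ball p ε ⊆ Q) (hQU : Q ⊆ U \ ball p δ)
    (hδε : δ ≤ ε) (hx : x ∈ ball p δ \ U) (hy : y ∈ ball p δ \ U)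
    (h : HasLogOn (fun z => (z - x) / (z - y)) U) :
    y ∈ connectedComponentIn (Uᶜ ∩ ball p ε) x := by
  have hlog : HasLogOn (fun z => (z - x) / (z - y)) (ball p δ)ᶜ :=
    hasLogOn_of_isPreconnected isOpen_ball.isClosed_compl (convex_ball p δ).isPreconnected
      (by rw [compl_compl]) hx.1 hy.1
  have hCc : (U ∪ (ball p ε)ᶜ)ᶜ = Uᶜ ∩ ball p ε := by rw [compl_union, compl_compl]
  have hC := h.union_of_subset hlog hU (isOpen_ball (x := p) (ε := ε)).isClosed_compl subset_rfl
    (compl_subset_compl.2 (ball_subset_ball hδε)) hQ (fun z hz => (hQU hz).1)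
    (fun z hz => (hQU hz).2) hUQ
  rw [← hCc]
  refine hC.mem_connectedComponentIn (hU.union isOpen_ball.isClosed_compl) ?_ ?_ ?_
  · rw [← mem_compl_iff, hCc]
    exact ⟨hx.2, ball_subset_ball hδε hx.1⟩
  · rw [← mem_compl_iff, hCc]
    exact ⟨hy.2, ball_subset_ball hδε hy.1⟩
  · rw [hCc]
    exact isBounded_ball.subset ((connectedComponentIn_subset _ _).trans inter_subset_right)

theorem reflTransGen_of_isPreconnected_iUnion {X ι : Type*} [TopologicalSpace X] {O : ι → Set X}
    (hO : ∀ i, IsOpen (O i)) (hne : ∀ i, (O i).Nonempty) (hc : IsPreconnected (⋃ i, O i))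
    (i j : ι) : Relation.ReflTransGen (fun i j => (O i ∩ O j).Nonempty) i j := by
  let R : Set ι := {j | Relation.ReflTransGen (fun i j => (O i ∩ O j).Nonempty) i j}
  by_contra hj
  obtain ⟨z, -, hz1, hz2⟩ := hc (⋃ k ∈ R, O k) (⋃ k ∈ Rᶜ, O k)
    (isOpen_biUnion fun k _ => hO k) (isOpen_biUnion fun k _ => hO k)
    (iUnion_subset fun k z hz => by
      by_cases hk : k ∈ R
      · exact Or.inl (mem_biUnion hk hz)
      · exact Or.inr (mem_biUnion (mem_compl hk) hz))
    (by
      obtain ⟨z, hz⟩ := hne i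
      exact ⟨z, mem_iUnion_of_mem i hz, mem_biUnion (Relation.ReflTransGen.refl : i ∈ R) hz⟩)
    (by
      obtain ⟨z, hz⟩ := hne j
      exact ⟨z, mem_iUnion_of_mem j hz, mem_biUnion (show j ∈ Rᶜ from hj) hz⟩)
  simp only [mem_iUnion] at hz1 hz2
  obtain ⟨k, hk, hzk⟩ := hz1
  obtain ⟨l, hl, hzl⟩ := hz2
  exact hl (Relation.ReflTransGen.tail hk ⟨z, hzk, hzl⟩)

/-- A connected union of disks, with a small ball around a non-interior point cut off, is contained
in a connected set staying away from the point. -/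
theorem exists_isPreconnected_iUnion_diff_ball {ι : Type*} [Finite ι] {V : ι → Set ℂ}
    (hV : ∀ i, ∃ H G, DiskParam (V i) H G) (hc : IsPreconnected (⋃ i, interior (V i))) {p : ℂ}
    (hp : ∀ i, p ∉ interior (V i)) {ε : ℝ} (hε : 0 < ε) :
    ∃ Q, IsPreconnected Q ∧ IsClosed Q ∧ (⋃ i, V i) \ ball p ε ⊆ Q ∧ Q ⊆ ⋃ i, V i ∧ p ∉ Q := by
  have hev : ∀ᶠ r in nhdsWithin (0 : ℝ) (Ioi 0), ∀ i j, (interior (V i) ∩ interior (V j)).Nonempty →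
      ((V i ∩ V j) \ ball p r).Nonempty := by
    simp only [Filter.eventually_all]
    rintro i j ⟨c, hci, hcj⟩
    have hcp : 0 < dist c p := dist_pos.2 fun h => hp i (h ▸ hci)
    filter_upwards [Ioo_mem_nhdsGT hcp] with r hr
    exact ⟨c, ⟨interior_subset hci, interior_subset hcj⟩, fun h => absurd h (not_lt.2 hr.2.le)⟩
  obtain ⟨r, hr, hr0⟩ := (hev.and (Ioc_mem_nhdsGT hε)).exists
  choose H G hHG using hV
  choose Q hQ1 hQ2 hQ3 hQ4 hQ5 using fun i =>
    (hHG i).exists_isPreconnected_diff_ball (hp i) hr0.1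
  refine ⟨⋃ i, Q i, ?_, isClosed_iUnion_of_finite hQ2, ?_, iUnion_mono hQ4, by simpa using hQ5⟩
  · refine IsPreconnected.iUnion_of_reflTransGen hQ1 fun i j => ?_
    refine Relation.ReflTransGen.mono (fun i j hij => ?_) i j (reflTransGen_of_isPreconnected_iUnion
      (fun i => isOpen_interior) (fun i => (hHG i).nonempty_interior) hc i j)
    obtain ⟨c, hc1, hc2⟩ := hr i j hij
    exact ⟨c, hQ3 i ⟨hc1.1, hc2⟩, hQ3 j ⟨hc1.2, hc2⟩⟩
  · rintro z ⟨hz, hzp⟩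
    obtain ⟨i, hi⟩ := mem_iUnion.1 hz
    exact mem_iUnion_of_mem i (hQ3 i ⟨hi, fun h => hzp (ball_subset_ball hr0.2 h)⟩)

/-- An open set `W` is locally connected at its boundary points, in the sense that the part of `W`
near a given point lies in a small connected subset of `W`. -/
def LocallyConnectedAtBoundary (W : Set ℂ) : Prop :=
  ∀ p : ℂ, ∀ ε > 0, ∃ δ > 0, ∃ S, IsPreconnected S ∧ W ∩ ball p δ ⊆ S ∧ S ⊆ W ∩ ball p ε

theorem locallyConnectedAtBoundary_connectedComponentIn {ι : Type*} [Finite ι] {V : ι → Set ℂ}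
    (hV : ∀ i, ∃ H G, DiskParam (V i) H G) (hc : IsPreconnected (⋃ i, interior (V i))) (a : ℂ) :
    LocallyConnectedAtBoundary (connectedComponentIn (⋃ i, V i)ᶜ a) := by
  intro p ε hε
  have hWU := connectedComponentIn_subset (⋃ i, V i)ᶜ a
  set W := connectedComponentIn (⋃ i, V i)ᶜ a with hW
  by_cases hp : ∃ i, p ∈ interior (V i)
  · obtain ⟨i, hi⟩ := hp
    obtain ⟨δ, hδ, hball⟩ := Metric.isOpen_iff.1 isOpen_interior p hi
    refine ⟨δ, hδ, ∅, isPreconnected_empty, ?_, empty_subset _⟩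
    rintro z ⟨hzW, hz⟩
    exact hWU hzW (mem_iUnion_of_mem i (interior_subset (hball hz)))
  push Not at hp
  have hU : IsClosed (⋃ i, V i) := isClosed_iUnion_of_finite fun i => by
    obtain ⟨H, G, h⟩ := hV i
    exact h.isCompact.isClosed
  obtain ⟨Q, hQ1, hQ2, hQ3, hQ4, hQ5⟩ := exists_isPreconnected_iUnion_diff_ball hV hc hp hε
  obtain ⟨δ, hδ, hball⟩ := Metric.isOpen_iff.1 hQ2.isOpen_compl p hQ5
  refine ⟨min δ ε, lt_min hδ hε, ?_⟩
  rcases (W ∩ ball p (min δ ε)).eq_empty_or_nonempty with h | ⟨x, hxW, hx⟩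
  · exact ⟨∅, isPreconnected_empty, h.subset, empty_subset _⟩
  have hWx : W = connectedComponentIn (⋃ i, V i)ᶜ x := connectedComponentIn_eq hxW
  refine ⟨connectedComponentIn ((⋃ i, V i)ᶜ ∩ ball p ε) x, isPreconnected_connectedComponentIn,
    ?_, subset_inter ?_ ?_⟩
  · rintro y ⟨hyW, hy⟩
    refine HasLogOn.mem_connectedComponentIn_inter_ball hU hQ1 hQ3
      (fun z hz => ⟨hQ4 hz, fun hzp => ?_⟩) (min_le_right δ ε) ⟨hx, hWU hxW⟩ ⟨hy, hWU hyW⟩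
      (hasLogOn_of_isPreconnected hU isPreconnected_connectedComponentIn hWU hxW hyW)
    exact hball (ball_subset_ball (min_le_left _ _) hzp) hz
  · rw [hWx]
    exact connectedComponentIn_mono x inter_subset_left
  · exact (connectedComponentIn_subset _ _).trans inter_subset_right

theorem isPreconnected_compl_closedBall (R : ℝ) (hR : 0 ≤ R) :
    IsPreconnected (closedBall (0 : ℂ) R)ᶜ := by
  have : (closedBall (0 : ℂ) R)ᶜ =
      (fun q : ℝ × ℝ => (q.1 : ℂ) * Complex.exp (q.2 * Complex.I)) '' (Ioi R ×ˢ univ) := by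
    ext z
    constructor
    · intro hz
      refine ⟨(‖z‖, z.arg), ⟨by simpa using hz, trivial⟩, Complex.norm_mul_exp_arg_mul_I z⟩
    · rintro ⟨⟨r, t⟩, ⟨hr, -⟩, rfl⟩
      have hr' : R < r := hr
      simpa [Complex.norm_exp_ofReal_mul_I, abs_of_pos (hR.trans_lt hr')] using hr'
  rw [this]
  refine (isPreconnected_Ioi.prod isPreconnected_univ).image _ ?_
  fun_prop

theorem exists_compl_closedBall_subset {U : Set ℂ} (hU : Bornology.IsBounded U) {a : ℂ}
    (hW : ¬ Bornology.IsBounded (connectedComponentIn Uᶜ a)) :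
    ∃ R, (closedBall (0 : ℂ) R)ᶜ ⊆ connectedComponentIn Uᶜ a := by
  obtain ⟨R, hR, hUR⟩ := hU.subset_ball_lt 0 0
  refine ⟨R, ?_⟩
  obtain ⟨w, hw, hwR⟩ : ∃ w ∈ connectedComponentIn Uᶜ a, w ∈ (closedBall (0 : ℂ) R)ᶜ := by
    by_contra! h
    exact hW (isBounded_closedBall.subset fun w hw => notMem_compl_iff.1 (h w hw))
  rw [connectedComponentIn_eq hw]
  exact (isPreconnected_compl_closedBall R hR.le).subset_connectedComponentIn hwR
    (compl_subset_compl.2 (hUR.trans ball_subset_closedBall))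

/-- The complement of a finite union of disks with connected union of interiors has no relatively
isolated pieces: filling in all holes leaves a connected interior. -/
theorem isPreconnected_interior_compl {ι : Type*} [Finite ι] {V : ι → Set ℂ}
    (hV : ∀ i, ∃ H G, DiskParam (V i) H G) (hc : IsConnected (⋃ i, interior (V i))) {a : ℂ}
    (ha : a ∈ (⋃ i, V i)ᶜ) :
    IsPreconnected (interior (connectedComponentIn (⋃ i, V i)ᶜ a)ᶜ) := by
  classical
  have := Fintype.ofFinite ι
  have hVc : ∀ i, IsClosed (V i) := fun i => by
    obtain ⟨H, G, h⟩ := hV i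
    exact h.isCompact.isClosed
  have hVi : ∀ i, V i ⊆ closure (interior (V i)) := fun i => by
    obtain ⟨H, G, h⟩ := hV i
    exact h.subset_closure_interior
  have hWU := connectedComponentIn_subset (⋃ i, V i)ᶜ a
  have haW := mem_connectedComponentIn ha
  set W := connectedComponentIn (⋃ i, V i)ᶜ a with hW
  have hVW : ∀ i, V i ⊆ Wᶜ := fun i z hz hzW => hWU hzW (mem_iUnion_of_mem i hz)
  have hOD : ⋃ i, interior (V i) ⊆ interior Wᶜ := iUnion_subset fun i => interior_mono (hVW i)
  obtain ⟨o, ho⟩ := hc.nonempty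
  refine isPreconnected_of_forall o fun x hx => ?_
  by_cases hxU : x ∈ ⋃ i, V i
  · obtain ⟨i, hi⟩ := mem_iUnion.1 hxU
    refine ⟨insert x (⋃ i, interior (V i)), insert_subset hx hOD, mem_insert_of_mem _ ho,
      mem_insert _ _, hc.isPreconnected.subset_closure (subset_insert _ _)
        (insert_subset ?_ subset_closure)⟩
    exact closure_mono (subset_iUnion (fun i => interior (V i)) i) (hVi i hi)
  let P : Finset ι → Prop := fun J => a ∈ connectedComponentIn (⋃ i ∈ J, V i)ᶜ x
  obtain ⟨J, i, hJ, hJi⟩ : ∃ J i, P J ∧ ¬ P (insert i J) := by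
    by_contra! hcon
    have hall : ∀ J, P J := fun J => by
      induction J using Finset.induction with
      | empty => simp [P, connectedComponentIn_univ]
      | insert i J _ ih => exact hcon J i ih
    have h1 := hall Finset.univ
    simp only [P, Finset.mem_univ, iUnion_true] at h1
    have h2 : x ∈ W := by
      rw [hW, ← connectedComponentIn_eq h1]
      exact mem_connectedComponentIn hxU
    exact interior_subset hx h2
  have hUi : (⋃ j ∈ insert i J, V j)ᶜ = (⋃ j ∈ J, V j)ᶜ ∩ (V i)ᶜ := by
    rw [Finset.set_biUnion_insert, compl_union, inter_comm]
  have hUo : (⋃ i, V i)ᶜ ⊆ (⋃ j ∈ insert i J, V j)ᶜ :=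
    compl_subset_compl.2 (iUnion₂_subset fun j _ => subset_iUnion V j)
  have hJc : ∀ J : Finset ι, IsClosed (⋃ j ∈ J, V j) := fun J =>
    isClosed_biUnion_finset fun j _ => hVc j
  set C := connectedComponentIn (⋃ j ∈ insert i J, V j)ᶜ x with hC
  have hCo : IsOpen C := (hJc _).isOpen_compl.connectedComponentIn
  have hCU : C ⊆ (⋃ j ∈ insert i J, V j)ᶜ := connectedComponentIn_subset _ _
  have hxC : x ∈ C := mem_connectedComponentIn (hUo hxU)
  have hSU : connectedComponentIn (⋃ j ∈ J, V j)ᶜ x ⊆ (⋃ j ∈ J, V j)ᶜ :=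
    connectedComponentIn_subset _ _
  obtain ⟨p, hpS, hpC, hpC'⟩ := IsPreconnected.exists_mem_closure_diff
    (isPreconnected_connectedComponentIn (F := (⋃ j ∈ J, V j)ᶜ) (x := x)) hCo
    ⟨x, mem_connectedComponentIn ((hUi ▸ hUo hxU).1), hxC⟩ (fun h => hJi (h hJ))
  have hpV : p ∈ V i := by
    by_contra hpV
    refine hpC' (closure_connectedComponentIn_inter_subset ⟨hpC, ?_⟩)
    rw [hUi]
    exact ⟨hSU hpS, hpV⟩
  have hCV : C ⊆ (V i)ᶜ := hCU.trans (hUi.subset.trans inter_subset_right)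
  have hpint : p ∉ interior (V i) := by
    intro h
    obtain ⟨z, hz1, hz2⟩ := mem_closure_iff.1 hpC _ isOpen_interior h
    exact hCV hz2 (interior_subset hz1)
  obtain ⟨ε, hε, hεJ⟩ := Metric.isOpen_iff.1 (hJc J).isOpen_compl p (hSU hpS)
  obtain ⟨H, G, hHG⟩ := hV i
  obtain ⟨Q, hQ1, hQ2, hQ3, hQ4, hQ5⟩ := hHG.exists_isPreconnected_diff_ball hpint hε
  obtain ⟨δ, hδ, hδQ⟩ := Metric.isOpen_iff.1 hQ2.isOpen_compl p hQ5
  have hmin : 0 < min δ ε := lt_min hδ hε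
  obtain ⟨y, hy, hyC⟩ := mem_closure_iff.1 hpC _ isOpen_ball (mem_ball_self hmin)
  have hball : ball p (min δ ε) ⊆ V i ∪ C := by
    intro z hz
    by_cases hzV : z ∈ V i
    · exact Or.inl hzV
    right
    have h1 : z ∈ connectedComponentIn ((V i)ᶜ ∩ ball p ε) y := by
      refine HasLogOn.mem_connectedComponentIn_inter_ball (hVc i) hQ1 hQ3
        (fun w hw => ⟨hQ4 hw, fun hwp => ?_⟩) (min_le_right δ ε) ⟨hy, hCV hyC⟩ ⟨hz, hzV⟩
        (hHG.hasLogOn ?_ ?_)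
      · exact hδQ (ball_subset_ball (min_le_left _ _) hwp) hw
      · refine (continuousOn_id.sub continuousOn_const).div
          (continuousOn_id.sub continuousOn_const) fun w hw h0 => ?_
        exact hzV ((sub_eq_zero.1 h0) ▸ hw)
      · refine fun w hw => div_ne_zero (fun h0 => ?_) (fun h0 => ?_)
        · exact hCV hyC ((sub_eq_zero.1 h0) ▸ hw)
        · exact hzV ((sub_eq_zero.1 h0) ▸ hw)
    rw [hC, connectedComponentIn_eq hyC]
    refine connectedComponentIn_mono y ?_ h1
    rw [hUi, inter_comm]
    exact inter_subset_inter_left _ hεJ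
  have hCW : C ⊆ Wᶜ := by
    intro w hwC hwW
    refine hJi ?_
    change a ∈ C
    rw [hC, connectedComponentIn_eq hwC]
    exact isPreconnected_connectedComponentIn.subset_connectedComponentIn hwW
      (hWU.trans hUo) haW
  refine ⟨(C ∪ ball p (min δ ε)) ∪ ⋃ i, interior (V i), ?_, Or.inr ho, Or.inl (Or.inl hxC), ?_⟩
  · refine union_subset (union_subset ?_ ?_) hOD
    · exact interior_maximal hCW hCo
    · exact interior_maximal (hball.trans (union_subset (hVW i) hCW)) isOpen_ball
  · obtain ⟨z, hz1, hz2⟩ := mem_closure_iff.1 (hVi i hpV) _ isOpen_ball (mem_ball_self hmin)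
    exact (isPreconnected_connectedComponentIn.union y hyC hy
      (convex_ball p _).isPreconnected).union z (Or.inr hz1) (mem_iUnion_of_mem i hz2)
      hc.isPreconnected

theorem closure_interior_compl_connectedComponentIn {ι : Type*} [Finite ι] {V : ι → Set ℂ}
    (hV : ∀ i, ∃ H G, DiskParam (V i) H G) (a : ℂ) :
    closure (interior (connectedComponentIn (⋃ i, V i)ᶜ a)ᶜ) =
      (connectedComponentIn (⋃ i, V i)ᶜ a)ᶜ := by
  have hU : IsClosed (⋃ i, V i) := isClosed_iUnion_of_finite fun i => by
    obtain ⟨H, G, h⟩ := hV i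
    exact h.isCompact.isClosed
  have hWo : IsOpen (connectedComponentIn (⋃ i, V i)ᶜ a) := hU.isOpen_compl.connectedComponentIn
  refine (closure_minimal interior_subset hWo.isClosed_compl).antisymm fun x hx => ?_
  by_cases hxD : x ∈ interior (connectedComponentIn (⋃ i, V i)ᶜ a)ᶜ
  · exact subset_closure hxD
  rw [interior_compl, notMem_compl_iff] at hxD
  have hxU : x ∈ ⋃ i, V i := by
    by_contra h
    exact hx (closure_connectedComponentIn_inter_subset ⟨hxD, h⟩)
  obtain ⟨i, hi⟩ := mem_iUnion.1 hxU
  obtain ⟨H, G, h⟩ := hV i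
  refine closure_mono (interior_mono fun z hz hzW => ?_) (h.subset_closure_interior hi)
  exact connectedComponentIn_subset _ _ hzW (mem_iUnion_of_mem i hz)

/-! ### The Riemann map of a bounded domain with connected complement -/

/-- The disk automorphism sending `a` to `0`. -/
noncomputable def diskMobius (a z : ℂ) : ℂ := (z - a) / (1 - (starRingEnd ℂ) a * z)

theorem one_sub_conj_mul_ne_zero {a z : ℂ} (ha : ‖a‖ < 1) (hz : ‖z‖ ≤ 1) :
    1 - (starRingEnd ℂ) a * z ≠ 0 := by
  intro h
  have h1 : ‖(starRingEnd ℂ) a * z‖ = 1 := by rw [← sub_eq_zero.1 h, norm_one]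
  rw [norm_mul, RCLike.norm_conj] at h1
  nlinarith [norm_nonneg a, norm_nonneg z]

theorem norm_sq_one_sub_conj_mul_sub (a z : ℂ) :
    ‖1 - (starRingEnd ℂ) a * z‖ ^ 2 - ‖z - a‖ ^ 2 = (1 - ‖a‖ ^ 2) * (1 - ‖z‖ ^ 2) := by
  simp only [← Complex.normSq_eq_norm_sq, Complex.normSq_apply, Complex.sub_re, Complex.sub_im,
    Complex.mul_re, Complex.mul_im, Complex.conj_re, Complex.conj_im, Complex.one_re,
    Complex.one_im]
  ring

theorem norm_diskMobius_lt_one {a z : ℂ} (ha : ‖a‖ < 1) (hz : ‖z‖ < 1) :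
    ‖diskMobius a z‖ < 1 := by
  have h := norm_sq_one_sub_conj_mul_sub a z
  rw [diskMobius, norm_div, div_lt_one (norm_pos_iff.2 (one_sub_conj_mul_ne_zero ha hz.le))]
  refine lt_of_pow_lt_pow_left₀ 2 (norm_nonneg _) ?_
  have h1 : 0 < 1 - ‖a‖ ^ 2 := by nlinarith [norm_nonneg a]
  have h2 : 0 < 1 - ‖z‖ ^ 2 := by nlinarith [norm_nonneg z]
  nlinarith [mul_pos h1 h2]

theorem norm_diskMobius_le_one {a z : ℂ} (ha : ‖a‖ < 1) (hz : ‖z‖ ≤ 1) :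
    ‖diskMobius a z‖ ≤ 1 := by
  have h := norm_sq_one_sub_conj_mul_sub a z
  rw [diskMobius, norm_div, div_le_one (norm_pos_iff.2 (one_sub_conj_mul_ne_zero ha hz))]
  refine le_of_sq_le_sq ?_ (norm_nonneg _)
  have h1 : 0 ≤ 1 - ‖a‖ ^ 2 := by nlinarith [norm_nonneg a]
  have h2 : 0 ≤ 1 - ‖z‖ ^ 2 := by nlinarith [norm_nonneg z]
  nlinarith [mul_nonneg h1 h2]

theorem diskMobius_neg_diskMobius {a z : ℂ} (ha : ‖a‖ < 1) (hz : ‖z‖ ≤ 1) :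
    diskMobius (-a) (diskMobius a z) = z := by
  have h1 := one_sub_conj_mul_ne_zero ha hz
  have h2 := one_sub_conj_mul_ne_zero (a := -a) (by rwa [norm_neg]) (norm_diskMobius_le_one ha hz)
  have h3 : diskMobius a z * (1 - (starRingEnd ℂ) a * z) = z - a := div_mul_cancel₀ _ h1
  rw [diskMobius, div_eq_iff h2, map_neg]
  linear_combination h3

theorem diskMobius_diskMobius_neg {a z : ℂ} (ha : ‖a‖ < 1) (hz : ‖z‖ ≤ 1) :
    diskMobius a (diskMobius (-a) z) = z := by
  simpa using diskMobius_neg_diskMobius (a := -a) (by rwa [norm_neg]) hz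

theorem hasDerivAt_diskMobius {a z : ℂ} (ha : ‖a‖ < 1) (hz : ‖z‖ ≤ 1) :
    HasDerivAt (diskMobius a) ((1 - ‖a‖ ^ 2) / (1 - (starRingEnd ℂ) a * z) ^ 2) z := by
  have h1 := one_sub_conj_mul_ne_zero ha hz
  have h2 := ((hasDerivAt_id z).sub_const a).div
    (((hasDerivAt_id z).const_mul ((starRingEnd ℂ) a)).const_sub 1) h1
  refine h2.congr_deriv ?_
  rw [← Complex.conj_mul']
  simp only [id_eq]
  ring

theorem continuousOn_diskMobius {a : ℂ} (ha : ‖a‖ < 1) :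
    ContinuousOn (diskMobius a) (closedBall 0 1) := fun _ hz =>
  (hasDerivAt_diskMobius ha (mem_closedBall_zero_iff.1 hz)).continuousAt.continuousWithinAt

/-- A holomorphic branch of the square root on a domain in the disk which does not contain `0` and
has a connected complement in the closed disk. -/
theorem exists_differentiableOn_sq_eq {Ω : Set ℂ} (hΩo : IsOpen Ω) (hΩc : IsPreconnected Ω)
    (hΩ : Ω ⊆ ball 0 1) (h0 : (0 : ℂ) ∉ Ω) (hY : IsPreconnected (closedBall 0 1 \ Ω)) :
    ∃ s : ℂ → ℂ, DifferentiableOn ℂ s Ω ∧ ∀ z ∈ Ω, s z ^ 2 = z := by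
  rcases Ω.eq_empty_or_nonempty with rfl | ⟨w, hw⟩
  · exact ⟨0, differentiableOn_empty, by simp⟩
  have hne : Ωᶜ.Nonempty := ⟨0, h0⟩
  let C : ℕ → Set ℂ := fun n => {z | 1 / ((n : ℝ) + 1) ≤ infDist z Ωᶜ}
  have hC : ∀ n, IsClosed (C n) := fun n =>
    isClosed_le continuous_const (continuous_infDist_pt _)
  have hCΩ : ∀ n, C n ⊆ Ω := by
    intro n z hz
    by_contra hzΩ
    have h1 : (0 : ℝ) < 1 / ((n : ℝ) + 1) := by positivity
    have h2 : 1 / ((n : ℝ) + 1) ≤ infDist z Ωᶜ := hz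
    rw [infDist_zero_of_mem (mem_compl hzΩ)] at h2
    linarith
  have h1Ω : (1 : ℂ) ∈ closedBall 0 1 \ Ω := ⟨by simp, fun h => by simpa using hΩ h⟩
  have hlog : ∀ n, HasLogOn (fun z => z) (C n) := by
    intro n
    obtain ⟨u, hu, hue⟩ := hasLogOn_of_isPreconnected (hC n) hY (fun z hz h => hz.2 (hCΩ n h))
      (x := 0) (y := 1) ⟨by simp, h0⟩ h1Ω
    have hslit : ∀ z ∈ C n, 1 - z ∈ Complex.slitPlane := by
      intro z hz
      have := hΩ (hCΩ n hz)
      rw [mem_ball_zero_iff] at this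
      rw [sub_eq_add_neg]
      exact Complex.mem_slitPlane_of_norm_lt_one (by rwa [norm_neg])
    refine ⟨fun z => u z + Complex.log (1 - z) + Real.pi * Complex.I, ?_, fun z hz => ?_⟩
    · exact (hu.add (ContinuousOn.clog (by fun_prop) hslit)).add continuousOn_const
    · have hz1 : 1 - z ≠ 0 := Complex.slitPlane_ne_zero (hslit z hz)
      have hz2 : z - 1 ≠ 0 := by rwa [← neg_sub, neg_ne_zero]
      rw [Complex.exp_add, Complex.exp_add, hue z hz, Complex.exp_log hz1, Complex.exp_pi_mul_I]
      field_simp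
      ring
  have hCmono : ∀ m n, m ≤ n → C m ⊆ C n := by
    intro m n hmn z hz
    refine le_trans ?_ (show 1 / ((m : ℝ) + 1) ≤ infDist z Ωᶜ from hz)
    have : (m : ℝ) ≤ n := by exact_mod_cast hmn
    gcongr
  let T : ℕ → Set ℂ := fun n => connectedComponentIn (interior (C n)) w
  have hTC : ∀ n, T n ⊆ C n := fun n =>
    (connectedComponentIn_subset _ _).trans interior_subset
  have hTo : ∀ n, IsOpen (T n) := fun n => isOpen_interior.connectedComponentIn
  have hTmono : ∀ m n, m ≤ n → T m ⊆ T n := fun m n hmn =>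
    connectedComponentIn_mono w (interior_mono (hCmono m n hmn))
  have hcover : ∀ z ∈ Ω, ∃ n, z ∈ T n ∧ w ∈ T n := by
    intro z hz
    have hpath : IsPathConnected Ω := hΩo.isConnected_iff_isPathConnected.1 ⟨⟨w, hw⟩, hΩc⟩
    obtain ⟨γ, hγ⟩ := hpath.joinedIn w hw z hz
    have hcomp : IsCompact (range γ) := isCompact_range γ.continuous
    obtain ⟨q, ⟨t, rfl⟩, hmin⟩ := hcomp.exists_isMinOn (range_nonempty γ)
      (continuous_infDist_pt Ωᶜ).continuousOn
    have hpos : 0 < infDist (γ t) Ωᶜ := by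
      rw [← hΩo.isClosed_compl.notMem_iff_infDist_pos hne]
      exact fun h => h (hγ t)
    obtain ⟨n, hn⟩ := exists_nat_one_div_lt hpos
    have hsub : range γ ⊆ interior (C n) := by
      refine subset_trans (fun x hx => ?_) (interior_maximal
        (t := {z | 1 / ((n : ℝ) + 1) < infDist z Ωᶜ})
        (fun z hz => show 1 / ((n : ℝ) + 1) ≤ infDist z Ωᶜ from le_of_lt hz)
        (isOpen_lt continuous_const (continuous_infDist_pt _)))
      exact hn.trans_le (hmin hx)
    have hsub2 := (isPreconnected_range γ.continuous).subset_connectedComponentIn (x := w)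
      ⟨0, γ.source⟩ hsub
    exact ⟨n, hsub2 ⟨1, γ.target⟩, hsub2 ⟨0, γ.source⟩⟩
  have hw0 : w ≠ 0 := fun h => h0 (h ▸ hw)
  have hlog' : ∀ n, ∃ u : ℂ → ℂ, ContinuousOn u (T n) ∧ (∀ z ∈ T n, Complex.exp (u z) = z) ∧
      u w = Complex.log w := by
    intro n
    obtain ⟨u, hu, hue⟩ := hlog n
    by_cases hwT : w ∈ T n
    · refine ⟨fun z => u z - u w + Complex.log w, ?_, fun z hz => ?_, by ring⟩
      · exact ((hu.mono (hTC n)).sub continuousOn_const).add continuousOn_const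
      · rw [Complex.exp_add, Complex.exp_sub, hue z (hTC n hz), hue w (hTC n hwT),
          Complex.exp_log hw0]
        field_simp
    · have hT : T n = ∅ := by
        refine connectedComponentIn_eq_empty fun h => hwT (mem_connectedComponentIn h)
      exact ⟨fun _ => Complex.log w, continuousOn_const, by simp [hT], rfl⟩
  choose u hu hue huw using hlog'
  have hagree : ∀ m n, m ≤ n → w ∈ T m → ∀ z ∈ T m, u n z = u m z := by
    intro m n hmn hwm z hz
    obtain ⟨c, -, hc⟩ := (isPreconnected_connectedComponentIn (F := interior (C m))
      (x := w)).exists_eq_add_of_exp_eq ((hu n).mono (hTmono m n hmn)) (hu m) (fun z hz => by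
        rw [hue n z (hTmono m n hmn hz), hue m z hz])
    have hc0 : c = 0 := by
      have := hc w hwm
      rw [huw, huw] at this
      simpa using this.symm
    rw [hc z hz, hc0, add_zero]
  let v : ℂ → ℂ := fun z => Filter.limUnder Filter.atTop (fun n => u n z)
  have hv : ∀ n, w ∈ T n → ∀ z ∈ T n, v z = u n z := by
    intro n hwn z hz
    refine Filter.Tendsto.limUnder_eq (tendsto_const_nhds.congr' ?_)
    filter_upwards [Filter.eventually_ge_atTop n] with m hm
    exact (hagree n m hm hwn z hz).symm
  have hsq : ∀ z ∈ Ω, Complex.exp (v z / 2) ^ 2 = z := by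
    intro z hz
    obtain ⟨n, hn, hwn⟩ := hcover z hz
    rw [← Complex.exp_nat_mul, hv n hwn z hn]
    push_cast
    rw [mul_div_cancel₀ _ two_ne_zero, hue n z hn]
  refine ⟨fun z => Complex.exp (v z / 2), fun z hz => ?_, hsq⟩
  obtain ⟨n, hn, hwn⟩ := hcover z hz
  have hvc : ContinuousAt v z :=
    (((hu n).congr (hv n hwn)).continuousAt ((hTo n).mem_nhds hn))
  have hsc : ContinuousAt (fun z => Complex.exp (v z / 2)) z := by fun_prop
  have hd := HasDerivAt.of_local_left_inverse (f := fun y => y ^ 2) hsc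
    (hasDerivAt_pow 2 (Complex.exp (v z / 2)))
    (by simp [Complex.exp_ne_zero])
    (by filter_upwards [hΩo.mem_nhds hz] with y hy using hsq y hy)
  exact hd.differentiableAt.differentiableWithinAt

theorem isOpen_image_of_leftInvOn {D : Set ℂ} (hDo : IsOpen D) (hDc : IsPreconnected D)
    {f k : ℂ → ℂ} (hf : DifferentiableOn ℂ f D) (hk : ∀ z ∈ D, k (f z) = z) :
    IsOpen (f '' D) := by
  rcases (hf.analyticOnNhd hDo).is_constant_or_isOpen hDc with ⟨w, hw⟩ | h
  · have hsub : D ⊆ {k w} := fun z hz => by rw [mem_singleton_iff, ← hw z hz, hk z hz]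
    have : D = ∅ := by
      rw [← subset_empty_iff, ← interior_singleton (k w)]
      exact interior_maximal hsub hDo
    simp [this]
  · exact h D subset_rfl hDo

theorem isPreconnected_preimage_sq {Y : Set ℂ} (hY : IsPreconnected Y) (h0 : (0 : ℂ) ∈ Y) :
    IsPreconnected ((fun w : ℂ => w ^ 2) ⁻¹' Y) := by
  have hopen : IsOpenMap (fun w : ℂ => w ^ 2) := (Complex.isOpenQuotientMap_pow 2).isOpenMap
  have key : ∀ u v : Set ℂ, IsOpen u → IsOpen v → (fun w : ℂ => w ^ 2) ⁻¹' Y ⊆ u ∪ v →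
      (0 : ℂ) ∈ u → ((fun w : ℂ => w ^ 2) ⁻¹' Y ∩ v).Nonempty →
      ((fun w : ℂ => w ^ 2) ⁻¹' Y ∩ (u ∩ v)).Nonempty := by
    rintro u v hu hv huv h0u ⟨b, hbY, hbv⟩
    obtain ⟨y, hy, ⟨a, ⟨ha1, ha2⟩, hay⟩, c, hc, hcy⟩ := hY ((fun w : ℂ => w ^ 2) '' (u ∩ -u))
      ((fun w : ℂ => w ^ 2) '' v) (hopen _ (hu.inter hu.neg)) (hopen _ hv) (by
        intro y hy
        obtain ⟨w, hw⟩ := IsAlgClosed.exists_pow_nat_eq y two_pos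
        by_cases hwv : w ∈ v
        · exact Or.inr ⟨w, hwv, hw⟩
        by_cases hwv' : -w ∈ v
        · exact Or.inr ⟨-w, hwv', by simpa using hw⟩
        · have h1 : w ∈ u := (huv (show w ^ 2 ∈ Y from hw ▸ hy)).resolve_right hwv
          have h2 : -w ∈ u := (huv (show (-w) ^ 2 ∈ Y by
            rw [neg_sq, hw]
            exact hy)).resolve_right hwv'
          exact Or.inl ⟨w, ⟨h1, h2⟩, hw⟩)
      ⟨0, h0, 0, ⟨h0u, by simpa using h0u⟩, by simp⟩ ⟨b ^ 2, hbY, b, hbv, rfl⟩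
    have hcY : c ^ 2 ∈ Y := by rwa [show c ^ 2 = y from hcy]
    refine ⟨c, hcY, ?_, hc⟩
    rcases sq_eq_sq_iff_eq_or_eq_neg.1 (hcy.trans hay.symm) with rfl | rfl
    · exact ha1
    · exact ha2
  intro u v hu hv huv hu_out hv'
  rcases huv (show (0 : ℂ) ^ 2 ∈ Y by simpa using h0) with h | h
  · exact key u v hu hv huv h hv'
  · rw [inter_comm u v]
    exact key v u hv hu (by rwa [union_comm]) h hu_out

/-- A conformal embedding `f` of `D` in the unit disk, with inverse `k`, whose image has a connected
complement in the closed disk. -/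
structure DiskEmbedding (D : Set ℂ) (f k : ℂ → ℂ) : Prop where
  diff : DifferentiableOn ℂ f D
  norm_lt : ∀ z ∈ D, ‖f z‖ < 1
  diff_inv : DifferentiableOn ℂ k (f '' D)
  left_inv : ∀ z ∈ D, k (f z) = z
  compl : IsPreconnected (closedBall 0 1 \ f '' D)

theorem DiskEmbedding.mobius {D : Set ℂ} {f k : ℂ → ℂ} (h : DiskEmbedding D f k) {a : ℂ}
    (ha : ‖a‖ < 1) : DiskEmbedding D (diskMobius a ∘ f) (k ∘ diskMobius (-a)) := by
  have ha' : ‖-a‖ < 1 := by rwa [norm_neg]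
  refine ⟨fun z hz => ?_, fun z hz => norm_diskMobius_lt_one ha (h.norm_lt z hz), ?_, ?_, ?_⟩
  · exact
      (hasDerivAt_diskMobius ha (h.norm_lt z hz).le).differentiableAt.comp_differentiableWithinAt
      z (h.diff z hz)
  · rintro _ ⟨z, hz, rfl⟩
    have h1 := (hasDerivAt_diskMobius ha' (norm_diskMobius_lt_one ha
      (h.norm_lt z hz)).le).differentiableAt.differentiableWithinAt (s := diskMobius a ∘ f '' D)
    refine DifferentiableWithinAt.comp (t := f '' D) _ ?_ h1 ?_
    · simp only [Function.comp_apply]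
      rw [diskMobius_neg_diskMobius ha (h.norm_lt z hz).le]
      exact h.diff_inv _ (mem_image_of_mem f hz)
    · rintro _ ⟨w, hw, rfl⟩
      simp only [Function.comp_apply]
      rw [diskMobius_neg_diskMobius ha (h.norm_lt w hw).le]
      exact mem_image_of_mem f hw
  · intro z hz
    simp only [Function.comp_apply]
    rw [diskMobius_neg_diskMobius ha (h.norm_lt z hz).le, h.left_inv z hz]
  · have : closedBall 0 1 \ (diskMobius a ∘ f) '' D =
        diskMobius a '' (closedBall 0 1 \ f '' D) := by
      ext w
      constructor
      · rintro ⟨hw1, hw2⟩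
        rw [mem_closedBall_zero_iff] at hw1
        refine ⟨diskMobius (-a) w, ⟨?_, ?_⟩, diskMobius_diskMobius_neg ha hw1⟩
        · simpa using norm_diskMobius_le_one ha' hw1
        · rintro ⟨z, hz, hzw⟩
          refine hw2 ⟨z, hz, ?_⟩
          rw [Function.comp_apply, hzw, diskMobius_diskMobius_neg ha hw1]
      · rintro ⟨v, ⟨hv1, hv2⟩, rfl⟩
        rw [mem_closedBall_zero_iff] at hv1
        refine ⟨by simpa using norm_diskMobius_le_one ha hv1, ?_⟩
        rintro ⟨z, hz, hzv⟩
        refine hv2 ⟨z, hz, ?_⟩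
        have := congrArg (diskMobius (-a)) hzv
        rwa [Function.comp_apply, diskMobius_neg_diskMobius ha (h.norm_lt z hz).le,
          diskMobius_neg_diskMobius ha hv1] at this
    rw [this]
    exact h.compl.image _ ((continuousOn_diskMobius ha).mono sdiff_subset)

theorem DiskEmbedding.exists_sqrt {D : Set ℂ} {f k : ℂ → ℂ} (h : DiskEmbedding D f k)
    (hDo : IsOpen D) (hDc : IsPreconnected D) (h0 : (0 : ℂ) ∉ f '' D) :
    ∃ g, DiskEmbedding D g (fun w => k (w ^ 2)) ∧ ∀ z ∈ D, g z ^ 2 = f z := by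
  have hΩ : f '' D ⊆ ball 0 1 := by
    rintro _ ⟨z, hz, rfl⟩
    simpa using h.norm_lt z hz
  obtain ⟨s, hs, hsq⟩ := exists_differentiableOn_sq_eq
    (isOpen_image_of_leftInvOn hDo hDc h.diff h.left_inv)
    (hDc.image f h.diff.continuousOn) hΩ h0 h.compl
  have hsq' : ∀ z ∈ D, s (f z) ^ 2 = f z := fun z hz => hsq _ (mem_image_of_mem f hz)
  have hg : DifferentiableOn ℂ (s ∘ f) D := hs.comp h.diff (mapsTo_image f D)
  have hk : ∀ z ∈ D, k ((s ∘ f) z ^ 2) = z := fun z hz => by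
    rw [Function.comp_apply, hsq' z hz, h.left_inv z hz]
  have hgo : IsOpen ((s ∘ f) '' D) :=
    isOpen_image_of_leftInvOn (k := fun w => k (w ^ 2)) hDo hDc hg hk
  have hlt : ∀ z ∈ D, ‖(s ∘ f) z‖ < 1 := by
    intro z hz
    have h1 := h.norm_lt z hz
    rw [← hsq' z hz, norm_pow] at h1
    exact (pow_lt_one_iff_of_nonneg (norm_nonneg _) two_ne_zero).1 h1
  refine ⟨s ∘ f, ⟨hg, hlt, ?_, hk, ?_⟩, hsq'⟩
  · refine h.diff_inv.comp (by fun_prop) ?_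
    rintro _ ⟨z, hz, rfl⟩
    simp only [Function.comp_apply]
    rw [hsq' z hz]
    exact mem_image_of_mem f hz
  set Y := (fun w : ℂ => w ^ 2) ⁻¹' (closedBall 0 1 \ f '' D) with hYdef
  have hY : IsPreconnected Y := isPreconnected_preimage_sq h.compl ⟨by simp, h0⟩
  set N := -((s ∘ f) '' D) with hNdef
  have hNle : ∀ w ∈ N, ‖w‖ < 1 := by
    rintro w ⟨z, hz, hzw⟩
    rw [← norm_neg, ← hzw]
    exact hlt z hz
  have hdisj : ∀ w ∈ N, w ∉ (s ∘ f) '' D := by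
    rintro w ⟨z, hz, hzw⟩ ⟨z', hz', rfl⟩
    simp only [Function.comp_apply] at hzw
    have h1 : f z = f z' := by rw [← hsq' z hz, ← hsq' z' hz', hzw, neg_sq]
    rw [h1, self_eq_neg] at hzw
    have h2 := hsq' z' hz'
    rw [hzw] at h2
    exact h0 ⟨z', hz', by rw [← h2]; simp⟩
  have heq : closedBall 0 1 \ (s ∘ f) '' D = Y ∪ N := by
    ext w
    constructor
    · rintro ⟨hw1, hw2⟩
      by_cases hw : w ^ 2 ∈ f '' D
      · obtain ⟨z, hz, hzw⟩ := hw
        right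
        rw [← hsq' z hz] at hzw
        rcases sq_eq_sq_iff_eq_or_eq_neg.1 hzw with h | h
        · exact absurd ⟨z, hz, h⟩ hw2
        · exact ⟨z, hz, h⟩
      · left
        refine ⟨?_, hw⟩
        rw [mem_closedBall_zero_iff] at hw1 ⊢
        simpa using hw1
    · rintro (⟨hw1, hw2⟩ | hw)
      · refine ⟨?_, ?_⟩
        · rw [mem_closedBall_zero_iff, norm_pow] at hw1
          rw [mem_closedBall_zero_iff]
          exact (pow_le_one_iff_of_nonneg (norm_nonneg _) two_ne_zero).1 hw1
        · rintro ⟨z, hz, rfl⟩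
          exact hw2 ⟨z, hz, (hsq' z hz).symm⟩
      · exact ⟨by simpa using (hNle w hw).le, hdisj w hw⟩
  rw [heq]
  rcases N.eq_empty_or_nonempty with hN | hN
  · rwa [hN, union_empty]
  have hNo : IsOpen N := hgo.neg
  have hNp : IsPreconnected N := by
    rw [hNdef, ← image_neg_eq_neg]
    exact (hDc.image _ hg.continuousOn).image _ continuous_neg.continuousOn
  obtain ⟨p, -, hp1, hp2⟩ := isPreconnected_univ.exists_mem_closure_diff hNo
    (by rwa [univ_inter]) (fun h => by simpa using hNle 1 (h (mem_univ _)))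
  have hpY : p ∈ Y := by
    have : p ∈ closedBall 0 1 \ (s ∘ f) '' D := by
      refine ⟨closure_minimal (fun w hw => by simpa using (hNle w hw).le) isClosed_closedBall hp1,
        fun hp => ?_⟩
      obtain ⟨w, hw1, hw2⟩ := mem_closure_iff.1 hp1 _ hgo hp
      exact hdisj w hw2 hw1
    rw [heq] at this
    exact this.resolve_right hp2
  have hunion : Y ∪ N = Y ∪ insert p N := by
    rw [union_insert, insert_eq_of_mem (show p ∈ Y ∪ N from Or.inl hpY)]
  rw [hunion]
  exact hY.union p hpY (mem_insert _ _) (hNp.subset_closure (subset_insert _ _)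
    (insert_subset hp1 subset_closure))

/-- Koebe's construction: an embedding which is not onto can be expanded. -/
theorem DiskEmbedding.exists_expansion {D : Set ℂ} {f k : ℂ → ℂ} (h : DiskEmbedding D f k)
    (hDo : IsOpen D) (hDc : IsPreconnected D) {z₀ : ℂ} (hz₀ : z₀ ∈ D) (hf0 : f z₀ = 0) {a : ℂ}
    (ha : ‖a‖ < 1) (haf : a ∉ f '' D) :
    ∃ g l, DiskEmbedding D g l ∧ g z₀ = 0 ∧
      ‖deriv f z₀‖ * (1 + ‖a‖) = 2 * √‖a‖ * ‖deriv g z₀‖ := by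
  have ha' : ‖-a‖ < 1 := by rwa [norm_neg]
  have h1 := h.mobius ha
  obtain ⟨s, hs, hsq⟩ := h1.exists_sqrt hDo hDc (by
    rintro ⟨z, hz, hz0⟩
    refine haf ⟨z, hz, ?_⟩
    have := diskMobius_neg_diskMobius ha (h.norm_lt z hz).le
    rw [← this, show diskMobius a (f z) = 0 from hz0]
    simp [diskMobius])
  have hb := hs.norm_lt z₀ hz₀
  have hg := hs.mobius hb
  refine ⟨_, _, hg, by simp [diskMobius], ?_⟩
  set b := s z₀ with hbdef
  set g := diskMobius b ∘ s with hgdef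
  have hb' : ‖-b‖ < 1 := by rwa [norm_neg]
  have hg0 : g z₀ = 0 := by simp [hgdef, diskMobius, hbdef]
  have hb2 : b ^ 2 = -a := by
    rw [hbdef, hsq z₀ hz₀, Function.comp_apply, hf0]
    simp [diskMobius]
  have hnb : ‖b‖ ^ 2 = ‖a‖ := by rw [← norm_pow, hb2, norm_neg]
  have hfg : ∀ z ∈ D, f z = diskMobius (-a) (diskMobius (-b) (g z) ^ 2) := by
    intro z hz
    rw [hgdef, Function.comp_apply, diskMobius_neg_diskMobius hb (hs.norm_lt z hz).le, hsq z hz,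
      Function.comp_apply, diskMobius_neg_diskMobius ha (h.norm_lt z hz).le]
  have e1 : HasDerivAt g (deriv g z₀) z₀ :=
    (hg.diff.differentiableAt (hDo.mem_nhds hz₀)).hasDerivAt
  have e2 := hasDerivAt_diskMobius hb' (z := g z₀) (by simp [hg0])
  have e3 : diskMobius (-b) (g z₀) = b := by simp [hg0, diskMobius]
  have e4 := ((e2.comp z₀ e1).pow 2)
  have e5 := hasDerivAt_diskMobius ha' (z := (diskMobius (-b) (g z₀)) ^ 2) (by
    rw [e3, hb2]
    exact ha'.le)
  have e6 := (e5.comp z₀ e4).deriv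
  have e7 : deriv f z₀ = deriv (diskMobius (-a) ∘ ((diskMobius (-b) ∘ g) ^ 2)) z₀ := by
    refine Filter.EventuallyEq.deriv_eq ?_
    filter_upwards [hDo.mem_nhds hz₀] with z hz using hfg z hz
  rw [e7, e6, e3, hg0, hb2]
  have hsqrt : √‖a‖ = ‖b‖ := by rw [← hnb, Real.sqrt_sq (norm_nonneg _)]
  have hn : 0 < 1 - ‖a‖ ^ 2 := by nlinarith [norm_nonneg a]
  have hn1 : 0 < 1 - ‖a‖ := by linarith
  have hconj : 1 - (starRingEnd ℂ) (-a) * -a = ((1 - ‖a‖ ^ 2 : ℝ) : ℂ) := by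
    push_cast
    rw [← Complex.conj_mul']
    simp
  have hbC : (1 - (‖b‖ : ℂ) ^ 2) = ((1 - ‖a‖ : ℝ) : ℂ) := by
    push_cast
    rw [← hnb]
    push_cast
    ring
  have haC : (1 - (‖a‖ : ℂ) ^ 2) = ((1 - ‖a‖ ^ 2 : ℝ) : ℂ) := by push_cast; ring
  rw [hconj, norm_neg, norm_neg, hbC, haC]
  simp only [norm_mul, norm_div, norm_pow, Complex.norm_real, Real.norm_of_nonneg hn.le,
    Real.norm_of_nonneg hn1.le, Function.comp_apply, e3]
  rw [hsqrt]
  simp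
  field_simp
  ring

theorem exists_tendstoLocallyUniformlyOn_of_norm_le {ι : Type*} (φ : Ultrafilter ι) {U : Set ℂ}
    (hU : IsOpen U) {F : ι → ℂ → ℂ} (hF : ∀ n, DifferentiableOn ℂ (F n) U) {B : ℝ}
    (hB : ∀ n, ∀ z ∈ U, ‖F n z‖ ≤ B) :
    ∃ L, TendstoLocallyUniformlyOn F L φ U ∧ (∀ z ∈ U, ‖L z‖ ≤ B) ∧
      ∀ z ∈ U, Filter.Tendsto (fun n => F n z) φ (nhds (L z)) := by
  have hlim : ∀ z, ∃ l, z ∈ U → ‖l‖ ≤ B ∧ Filter.Tendsto (fun n => F n z) φ (nhds l) := by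
    intro z
    by_cases hz : z ∈ U
    · obtain ⟨l, hl, hle⟩ := (isCompact_closedBall (0 : ℂ) B).ultrafilter_le_nhds
        (φ.map fun n => F n z) (by
          rw [Filter.le_principal_iff]
          exact Filter.Eventually.of_forall (f := (φ : Filter ι)) fun n => by simpa using hB n z hz)
      exact ⟨l, fun _ => ⟨by simpa using hl, hle⟩⟩
    · exact ⟨0, fun h => absurd h hz⟩
  choose L hL using hlim
  refine ⟨L, ?_, fun z hz => (hL z hz).1, fun z hz => (hL z hz).2⟩
  rw [Metric.tendstoLocallyUniformlyOn_iff]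
  intro ε hε x hx
  obtain ⟨s, hs, hsU⟩ := Metric.isOpen_iff.1 hU x hx
  have hB0 : 0 ≤ B := by
    obtain ⟨n⟩ := (φ : Filter ι).nonempty_of_neBot
    exact (norm_nonneg _).trans (hB n x hx)
  have hlip : ∀ n, ∀ y ∈ ball x s, dist (F n y) (F n x) ≤ (B + B) / s * dist y x := by
    intro n y hy
    refine Complex.dist_le_div_mul_dist_of_mapsTo_ball ((hF n).mono hsU) (fun z hz => ?_) hy
    rw [mem_closedBall, dist_eq_norm]
    exact (norm_sub_le _ _).trans (add_le_add (hB n z (hsU hz)) (hB n x hx))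
  set δ := min s (ε / 3 / ((B + B) / s + 1)) with hδ
  have hpos : 0 < (B + B) / s + 1 := by positivity
  have hδ0 : 0 < δ := lt_min hs (by positivity)
  have hsmall : ∀ n, ∀ y ∈ ball x δ, dist (F n y) (F n x) ≤ ε / 3 := by
    intro n y hy
    rw [mem_ball] at hy
    refine (hlip n y (hy.trans_le (min_le_left _ _))).trans ?_
    have h1 : dist y x ≤ ε / 3 / ((B + B) / s + 1) := hy.le.trans (min_le_right _ _)
    rw [le_div_iff₀ hpos] at h1
    nlinarith [dist_nonneg (x := y) (y := x)]
  refine ⟨ball x δ, mem_nhdsWithin_of_mem_nhds (ball_mem_nhds x hδ0), ?_⟩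
  filter_upwards [Metric.tendsto_nhds.1 (hL x hx).2 (ε / 3) (by positivity)] with n hn y hy
  have hyU : y ∈ U := hsU (ball_subset_ball (min_le_left _ _) hy)
  have h1 : dist (L y) (L x) ≤ ε / 3 :=
    le_of_tendsto ((hL y hyU).2.dist (hL x hx).2)
      (Filter.Eventually.of_forall fun m => hsmall m y hy)
  have h2 := hsmall n y hy
  calc dist (L y) (F n y) ≤ dist (L y) (L x) + dist (L x) (F n x) + dist (F n x) (F n y) :=
        dist_triangle4 _ _ _ _
    _ < ε := by
        rw [dist_comm (L x), dist_comm (F n x) (F n y)]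
        linarith

/-- Hurwitz's theorem on omitted values. -/
theorem TendstoLocallyUniformlyOn.eventually_eq_of_omitted {ι : Type*} {φ : Filter ι} [φ.NeBot]
    {U : Set ℂ} (hU : IsOpen U) {F : ι → ℂ → ℂ} {L : ℂ → ℂ}
    (h : TendstoLocallyUniformlyOn F L φ U) (hF : ∀ n, DifferentiableOn ℂ (F n) U) {b w : ℂ}
    (hb : ∀ n, ∀ z ∈ U, F n z ≠ b) (hw : w ∈ U) (hLw : L w = b) : ∀ᶠ z in nhds w, L z = b := by
  have hL : DifferentiableOn ℂ L U := h.differentiableOn (Filter.Eventually.of_forall hF) hU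
  have han : AnalyticAt ℂ (fun z => L z - b) w :=
    ((hL.sub_const b).analyticOnNhd hU) w hw
  refine han.eventually_eq_zero_or_eventually_ne_zero.elim
    (fun h1 => h1.mono fun z hz => sub_eq_zero.1 hz) fun h1 => ?_
  exfalso
  obtain ⟨r, hr, hrU⟩ := Metric.mem_nhds_iff.1 (Filter.inter_mem (hU.mem_nhds hw)
    (eventually_nhdsWithin_iff.1 h1))
  have hr2 : closedBall w (r / 2) ⊆ ball w r := closedBall_subset_ball (by linarith)
  have hcU : closedBall w (r / 2) ⊆ U := fun z hz => (hrU (hr2 hz)).1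
  obtain ⟨z₁, hz₁, hmin⟩ := (isCompact_sphere w (r / 2)).exists_isMinOn
    (NormedSpace.sphere_nonempty.2 (by positivity)) (f := fun z => ‖L z - b‖)
    ((hL.continuousOn.mono (sphere_subset_closedBall.trans hcU)).sub continuousOn_const).norm
  have hz₁ne : z₁ ≠ w := ne_of_mem_sphere hz₁ (by positivity)
  have hε : 0 < ‖L z₁ - b‖ :=
    norm_pos_iff.2 ((hrU (hr2 (sphere_subset_closedBall hz₁))).2 hz₁ne)
  set ε := ‖L z₁ - b‖
  obtain ⟨n, hn⟩ := (Metric.tendstoUniformlyOn_iff.1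
    ((tendstoLocallyUniformlyOn_iff_forall_isCompact hU).1 h _ hcU (isCompact_closedBall _ _))
      (ε / 3) (by positivity)).exists
  have hq : DiffContOnCl ℂ (fun z => (F n z - b)⁻¹) (ball w (r / 2)) := by
    refine DifferentiableOn.diffContOnCl ?_
    refine DifferentiableOn.inv (((hF n).mono ?_).sub_const b) fun z hz => ?_
    · exact closure_ball_subset_closedBall.trans hcU
    · exact sub_ne_zero.2 (hb n z (hcU (closure_ball_subset_closedBall hz)))
  have hbd : ∀ z ∈ frontier (ball w (r / 2)), ‖(F n z - b)⁻¹‖ ≤ (2 * ε / 3)⁻¹ := by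
    intro z hz
    rw [frontier_ball w (by positivity)] at hz
    rw [norm_inv]
    refine inv_anti₀ (by positivity) ?_
    have h2 : ε ≤ ‖L z - b‖ := hmin hz
    have h3 := hn z (sphere_subset_closedBall hz)
    rw [dist_eq_norm] at h3
    have h4 := norm_sub_le_norm_sub_add_norm_sub (L z) (F n z) b
    linarith
  have hfin := Complex.norm_le_of_forall_mem_frontier_norm_le isBounded_ball hq hbd
    (subset_closure (mem_ball_self (x := w) (by positivity)))
  rw [norm_inv] at hfin
  have h5 : 2 * ε / 3 ≤ ‖F n w - b‖ :=
    (inv_le_inv₀ (norm_pos_iff.2 (sub_ne_zero.2 (hb n w hw))) (by positivity)).1 hfin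
  have h6 := hn w (mem_closedBall_self (by positivity))
  rw [dist_eq_norm, hLw, norm_sub_rev] at h6
  linarith

theorem exists_diskEmbedding {D : Set ℂ} (hDb : Bornology.IsBounded D) (hDc : IsPreconnected Dᶜ)
    (z₀ : ℂ) : ∃ f k, DiskEmbedding D f k ∧ f z₀ = 0 := by
  obtain ⟨R, hR, hDR⟩ := hDb.subset_ball_lt 0 z₀
  have hRC : (R : ℂ) ≠ 0 := Complex.ofReal_ne_zero.2 hR.ne'
  have hlt : ∀ z ∈ D, ‖(z - z₀) / R‖ < 1 := by
    intro z hz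
    rw [norm_div, Complex.norm_real, Real.norm_of_nonneg hR.le, div_lt_one hR, ← dist_eq_norm]
    exact hDR hz
  refine ⟨fun z => (z - z₀) / R, fun w => z₀ + R * w, ⟨by fun_prop, hlt, by fun_prop,
    fun z _ => ?_, ?_⟩, by simp⟩
  · field_simp
    ring
  have hpos : ∀ z : ℂ, 0 < max 1 ‖z‖ := fun z => lt_max_of_lt_left one_pos
  have hρ : Continuous fun z : ℂ => (max 1 ‖z‖)⁻¹ • z :=
    ((continuous_const.max continuous_norm).inv₀ fun z => (hpos z).ne').smul continuous_id
  have hρ1 : ∀ z : ℂ, ‖(max 1 ‖z‖)⁻¹ • z‖ = ‖z‖ / max 1 ‖z‖ := fun z => by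
    rw [norm_smul, norm_inv, Real.norm_of_nonneg (hpos z).le, inv_mul_eq_div]
  convert (hDc.image (fun z => (z - z₀) / (R : ℂ)) (by fun_prop)).image _ hρ.continuousOn using 1
  ext w
  constructor
  · rintro ⟨hw1, hw2⟩
    rw [mem_closedBall_zero_iff] at hw1
    refine ⟨w, ⟨z₀ + R * w, fun h => hw2 ⟨_, h, ?_⟩, ?_⟩, ?_⟩
    · field_simp
      ring
    · field_simp
      ring
    · simp [max_eq_left hw1]
  · rintro ⟨v, ⟨z, hz, rfl⟩, rfl⟩
    set v := (z - z₀) / (R : ℂ) with hv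
    refine ⟨?_, ?_⟩
    · rw [mem_closedBall_zero_iff]
      show ‖(max 1 ‖v‖)⁻¹ • v‖ ≤ 1
      rw [hρ1, div_le_one (hpos v)]
      exact le_max_right _ _
    · rintro ⟨y, hy, hyv⟩
      simp only at hyv
      have h1 := hlt y hy
      rw [hyv, hρ1, div_lt_one (hpos v)] at h1
      have h2 : ‖v‖ < 1 := by
        rcases lt_max_iff.1 h1 with h | h
        · exact h
        · exact absurd h (lt_irrefl _)
      rw [max_eq_left h2.le, inv_one, one_smul, div_left_inj' hRC, sub_left_inj] at hyv
      exact hz (hyv ▸ hy)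

theorem exists_diskEmbedding_ball_subset {D : Set ℂ} (hDo : IsOpen D) (hD : IsPreconnected D)
    (hDb : Bornology.IsBounded D) (hDc : IsPreconnected Dᶜ) {z₀ : ℂ} (hz₀ : z₀ ∈ D) {ε : ℝ}
    (hε : 0 < ε) (hε1 : ε < 1) :
    ∃ f k, DiskEmbedding D f k ∧ f z₀ = 0 ∧ ball 0 (1 - ε) ⊆ f '' D := by
  obtain ⟨r, hr, hrD⟩ := Metric.isOpen_iff.1 hDo z₀ hz₀
  set S : Set ℝ := {m | ∃ f k, DiskEmbedding D f k ∧ f z₀ = 0 ∧ ‖deriv f z₀‖ = m} with hS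
  have hbdd : BddAbove S := by
    refine ⟨1 / r, ?_⟩
    rintro _ ⟨f, k, hf, hf0, rfl⟩
    refine Complex.norm_deriv_le_div_of_mapsTo_ball (hf.diff.mono hrD) (fun z hz => ?_) hr
    rw [hf0]
    simpa using (hf.norm_lt z (hrD hz)).le
  have hpos : ∀ f k, DiskEmbedding D f k → f z₀ = 0 → 0 < ‖deriv f z₀‖ := by
    intro f k hf hf0
    rw [norm_pos_iff]
    intro h0
    have h1 := (hf.diff.differentiableAt (hDo.mem_nhds hz₀)).hasDerivAt
    have h2 := (hf.diff_inv.differentiableAt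
      ((isOpen_image_of_leftInvOn hDo hD hf.diff hf.left_inv).mem_nhds
        (mem_image_of_mem f hz₀))).hasDerivAt
    have h3 := (h2.comp z₀ h1).congr_of_eventuallyEq (f₁ := id) (by
      filter_upwards [hDo.mem_nhds hz₀] with z hz using (hf.left_inv z hz).symm)
    rw [h0, mul_zero] at h3
    exact one_ne_zero ((hasDerivAt_id z₀).unique h3)
  obtain ⟨f₀, k₀, hf₀, hf₀0⟩ := exists_diskEmbedding hDb hDc z₀
  have hM : 0 < sSup S :=
    (hpos f₀ k₀ hf₀ hf₀0).trans_le (le_csSup hbdd ⟨f₀, k₀, hf₀, hf₀0, rfl⟩)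
  obtain ⟨_, ⟨f, k, hf, hf0, rfl⟩, hfM⟩ := exists_lt_of_lt_csSup
    (s := S) ⟨_, f₀, k₀, hf₀, hf₀0, rfl⟩
    (show sSup S * (1 - ε ^ 2 / 8) < sSup S by nlinarith [mul_pos hM (pow_pos hε 2)])
  refine ⟨f, k, hf, hf0, fun a ha => ?_⟩
  by_contra haf
  rw [mem_ball_zero_iff] at ha
  obtain ⟨g, l, hg, hg0, hfg⟩ :=
    hf.exists_expansion hDo hD hz₀ hf0 (ha.trans (by linarith)) haf
  have hgM : ‖deriv g z₀‖ ≤ sSup S := le_csSup hbdd ⟨g, l, hg, hg0, rfl⟩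
  have ht0 : 0 ≤ √‖a‖ := Real.sqrt_nonneg _
  have ht : √‖a‖ ^ 2 = ‖a‖ := Real.sq_sqrt (norm_nonneg a)
  set t := √‖a‖
  rw [← ht] at hfg ha
  have ht1 : t ≤ 1 - ε / 2 := by nlinarith
  have h1 : (1 - t) ^ 2 ≥ ε ^ 2 / 4 := by nlinarith
  have h2 : sSup S * (1 - ε ^ 2 / 8) * (1 + t ^ 2) < 2 * t * sSup S := by
    calc _ < ‖deriv f z₀‖ * (1 + t ^ 2) := by gcongr
      _ = 2 * t * ‖deriv g z₀‖ := hfg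
      _ ≤ _ := by gcongr
  have h3 : (1 - ε ^ 2 / 8) * (1 + t ^ 2) < 2 * t := by
    by_contra! h
    nlinarith [mul_le_mul_of_nonneg_left h hM.le]
  nlinarith [mul_nonneg (sq_nonneg ε) (show (0 : ℝ) ≤ 1 - t ^ 2 by nlinarith)]

/-- A conformal map `g` of the unit disk onto `D`, with inverse `f`. -/
structure IsRiemannMap (D : Set ℂ) (f g : ℂ → ℂ) : Prop where
  diff_inv : DifferentiableOn ℂ f D
  diff : DifferentiableOn ℂ g (ball 0 1)
  mapsTo_inv : MapsTo f D (ball 0 1)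
  mapsTo : MapsTo g (ball 0 1) D
  right_inv : ∀ z ∈ D, g (f z) = z
  left_inv : ∀ w ∈ ball (0 : ℂ) 1, f (g w) = w

/-- The Riemann mapping theorem for bounded domains with connected complement. -/
theorem exists_riemann_map {D : Set ℂ} (hDo : IsOpen D) (hD : IsConnected D)
    (hDb : Bornology.IsBounded D) (hDc : IsPreconnected Dᶜ) :
    ∃ f g, IsRiemannMap D f g := by
  obtain ⟨z₀, hz₀⟩ := hD.nonempty
  let r : ℕ → ℝ := fun n => 1 - 1 / ((n : ℝ) + 2)
  have hn2 : ∀ n : ℕ, (0 : ℝ) < (n : ℝ) + 2 := fun n => by positivity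
  have hinv : ∀ n : ℕ, 1 / ((n : ℝ) + 2) < 1 := fun n => by
    rw [div_lt_one (hn2 n)]
    linarith [(Nat.cast_nonneg n : (0 : ℝ) ≤ n)]
  have hr0 : ∀ n, 0 < r n := fun n => sub_pos.2 (hinv n)
  have hr1 : ∀ n, r n < 1 := fun n => sub_lt_self _ (one_div_pos.2 (hn2 n))
  choose F K hF hF0 hsub using fun n : ℕ =>
    exists_diskEmbedding_ball_subset hDo hD.isPreconnected hDb hDc hz₀
      (one_div_pos.2 (hn2 n)) (hinv n)
  have hmem : ∀ n, ∀ w ∈ ball (0 : ℂ) 1, (r n : ℂ) * w ∈ F n '' D := by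
    intro n w hw
    refine hsub n ?_
    rw [mem_ball_zero_iff] at hw ⊢
    rw [norm_mul, Complex.norm_real, Real.norm_of_nonneg (hr0 n).le]
    exact mul_lt_of_lt_one_right (hr0 n) hw
  have hKD : ∀ n, ∀ y ∈ F n '' D, K n y ∈ D ∧ F n (K n y) = y := by
    rintro n _ ⟨z, hz, rfl⟩
    rw [(hF n).left_inv z hz]
    exact ⟨hz, rfl⟩
  let G : ℕ → ℂ → ℂ := fun n w => K n (r n * w)
  have hGd : ∀ n, DifferentiableOn ℂ (G n) (ball 0 1) := fun n =>
    (hF n).diff_inv.comp (by fun_prop) (hmem n)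
  have hGD : ∀ n, ∀ w ∈ ball (0 : ℂ) 1, G n w ∈ D := fun n w hw => (hKD n _ (hmem n w hw)).1
  obtain ⟨B, hB⟩ := hDb.exists_norm_le
  let φ : Ultrafilter ℕ := Filter.hyperfilter ℕ
  have hφ : (φ : Filter ℕ) ≤ Filter.atTop := Nat.hyperfilter_le_atTop
  have hrlim : Filter.Tendsto (fun n => (r n : ℂ)) φ (nhds 1) := by
    have h1 : Filter.Tendsto r Filter.atTop (nhds (1 - 0)) :=
      tendsto_const_nhds.sub (tendsto_const_nhds.div_atTop
        (Filter.tendsto_atTop_add_const_right _ _ tendsto_natCast_atTop_atTop))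
    rw [sub_zero] at h1
    have h2 := (Complex.continuous_ofReal.tendsto 1).comp (h1.mono_left hφ)
    rwa [Complex.ofReal_one] at h2
  obtain ⟨f, hfl, hf1, hft⟩ := exists_tendstoLocallyUniformlyOn_of_norm_le φ hDo
    (fun n => (hF n).diff) (fun n z hz => ((hF n).norm_lt z hz).le)
  obtain ⟨g, hgl, hgB, hgt⟩ := exists_tendstoLocallyUniformlyOn_of_norm_le φ isOpen_ball
    hGd (fun n z hz => hB _ (hGD n z hz))
  have hfd : DifferentiableOn ℂ f D :=
    hfl.differentiableOn (Filter.Eventually.of_forall fun n => (hF n).diff) hDo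
  have hgd : DifferentiableOn ℂ g (ball 0 1) :=
    hgl.differentiableOn (Filter.Eventually.of_forall hGd) isOpen_ball
  have hf0 : f z₀ = 0 :=
    tendsto_nhds_unique (hft z₀ hz₀) (by simp only [hF0]; exact tendsto_const_nhds)
  have hfm : MapsTo f D (ball 0 1) := by
    intro z hz
    rw [mem_ball_zero_iff]
    refine (hf1 z hz).lt_of_ne fun h => ?_
    have := Complex.norm_eqOn_of_isPreconnected_of_isMaxOn hD.isPreconnected hDo hfd hz
      (fun w hw => by
        show ‖f w‖ ≤ ‖f z‖
        exact h ▸ hf1 w hw) hz₀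
    simp [hf0, h] at this
  have hgf : ∀ z ∈ D, g (f z) = z := by
    intro z hz
    have h1 : Filter.Tendsto (fun n => F n z / r n) φ (nhds (f z)) := by
      have := (hft z hz).div hrlim one_ne_zero
      rwa [div_one] at this
    have h2 := hgl.tendsto_comp (hgd.continuousOn _ (hfm hz)) (hfm hz)
      (by rw [isOpen_ball.nhdsWithin_eq (hfm hz)]; exact h1)
    refine tendsto_nhds_unique h2 (Filter.Tendsto.congr (fun n => ?_) tendsto_const_nhds)
    have h3 : (r n : ℂ) ≠ 0 := Complex.ofReal_ne_zero.2 (hr0 n).ne'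
    simp only [G]
    rw [mul_div_cancel₀ _ h3, (hF n).left_inv z hz]
  have hgm : MapsTo g (ball 0 1) D := by
    intro w hw
    by_contra hb
    have h1 := hgl.eventually_eq_of_omitted isOpen_ball hGd
      (fun n z hz (h : G n z = g w) => hb (h ▸ hGD n z hz)) hw rfl
    have h2 := (hgd.analyticOnNhd isOpen_ball).eqOn_of_preconnected_of_eventuallyEq
      (analyticOnNhd_const (v := g w)) (convex_ball (0 : ℂ) 1).isPreconnected hw h1
    have h3 : g (f z₀) = g w := h2 (hfm hz₀)
    rw [hgf z₀ hz₀] at h3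
    exact hb (h3 ▸ hz₀)
  refine ⟨f, g, hfd, hgd, hfm, hgm, hgf, fun w hw => ?_⟩
  have h1 := hfl.tendsto_comp (hfd.continuousOn _ (hgm hw)) (hgm hw)
    (by rw [hDo.nhdsWithin_eq (hgm hw)]; exact hgt w hw)
  refine tendsto_nhds_unique h1 (Filter.Tendsto.congr (fun n => ?_)
    (show Filter.Tendsto (fun n => (r n : ℂ) * w) φ (nhds w) by simpa using hrlim.mul_const w))
  exact (hKD n _ (hmem n w hw)).2.symm

/-! ### The length-area estimate -/

theorem sq_div_le_integral_norm_sq {c c' : ℝ → ℂ} {a b L δ : ℝ} (hab : a ≤ b) (hL : b - a ≤ L)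
    (hL0 : 0 < L) (hδ : 0 ≤ δ) (hc : ∀ t ∈ Icc a b, HasDerivAt c (c' t) t)
    (hc' : ContinuousOn c' (Icc a b)) (h : δ ≤ ‖c b - c a‖) :
    δ ^ 2 / L ≤ ∫ t in a..b, ‖c' t‖ ^ 2 := by
  rw [← uIcc_of_le hab] at hc hc'
  have hi : IntervalIntegrable (fun t => ‖c' t‖) MeasureTheory.volume a b :=
    hc'.norm.intervalIntegrable
  have hi2 : IntervalIntegrable (fun t => ‖c' t‖ ^ 2) MeasureTheory.volume a b :=
    (hc'.norm.pow 2).intervalIntegrable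
  have h1 : δ ≤ ∫ t in a..b, ‖c' t‖ := by
    rw [← intervalIntegral.integral_eq_sub_of_hasDerivAt hc hc'.intervalIntegrable] at h
    exact h.trans (intervalIntegral.norm_integral_le_integral_norm hab)
  have h2 : 0 ≤ ∫ t in a..b, (‖c' t‖ - δ / L) ^ 2 :=
    intervalIntegral.integral_nonneg hab fun t _ => sq_nonneg _
  have h3 : ∫ t in a..b, (‖c' t‖ - δ / L) ^ 2 = (∫ t in a..b, ‖c' t‖ ^ 2) -
      2 * (δ / L) * (∫ t in a..b, ‖c' t‖) + (b - a) * (δ / L) ^ 2 := by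
    rw [← intervalIntegral.integral_const_mul, ← intervalIntegral.integral_sub hi2
      (hi.const_mul _), show (b - a) * (δ / L) ^ 2 = ∫ _ in a..b, (δ / L) ^ 2 by simp,
      ← intervalIntegral.integral_add (hi2.sub (hi.const_mul _)) intervalIntegrable_const]
    congr 1
    ext t
    ring
  rw [h3] at h2
  have h4 : (b - a) * (δ / L) ^ 2 ≤ δ ^ 2 / L := by
    calc (b - a) * (δ / L) ^ 2 ≤ L * (δ / L) ^ 2 := by gcongr
      _ = δ ^ 2 / L := by field_simp
  have h5 : 2 * (δ / L) * δ ≤ 2 * (δ / L) * ∫ t in a..b, ‖c' t‖ := by gcongr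
  have h6 : 2 * (δ / L) * δ = 2 * (δ ^ 2 / L) := by ring
  linarith

theorem polar_mem_ball_iff {r θ : ℝ} (hr : 0 < r) :
    (r : ℂ) * (Real.cos θ + Real.sin θ * Complex.I) ∈ ball (1 : ℂ) 1 ↔ r < 2 * Real.cos θ := by
  rw [mem_ball, dist_eq_norm, ← sq_lt_one_iff₀ (norm_nonneg _), ← Complex.normSq_eq_norm_sq,
    Complex.normSq_apply]
  simp only [Complex.sub_re, Complex.sub_im, Complex.mul_re, Complex.mul_im, Complex.add_re,
    Complex.add_im, Complex.ofReal_re, Complex.ofReal_im, Complex.I_re, Complex.I_im,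
    Complex.one_re, Complex.one_im]
  have h : (r * (Real.cos θ + (Real.sin θ * 0 - 0 * 1)) - 0 * (0 + (Real.sin θ * 1 + 0 * 0)) - 1) *
        (r * (Real.cos θ + (Real.sin θ * 0 - 0 * 1)) - 0 * (0 + (Real.sin θ * 1 + 0 * 0)) - 1) +
      (r * (0 + (Real.sin θ * 1 + 0 * 0)) + 0 * (Real.cos θ + (Real.sin θ * 0 - 0 * 1)) - 0) *
        (r * (0 + (Real.sin θ * 1 + 0 * 0)) + 0 * (Real.cos θ + (Real.sin θ * 0 - 0 * 1)) - 0) =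
      r * (r - 2 * Real.cos θ) + 1 := by
    linear_combination r ^ 2 * Real.sin_sq_add_cos_sq θ
  rw [h]
  constructor
  · intro h1
    by_contra! h2
    nlinarith [mul_nonneg hr.le (sub_nonneg.2 h2)]
  · intro h1
    nlinarith [mul_pos hr (sub_pos.2 h1)]

/-- The conformal area density, extended by zero outside `ball 1 1`. -/
noncomputable def areaDensity (G : ℂ → ℂ) : ℂ → ENNReal :=
  (ball (1 : ℂ) 1).indicator fun z => ENNReal.ofReal (‖deriv G z‖ ^ 2)

theorem measurable_areaDensity (G : ℂ → ℂ) : Measurable (areaDensity G) :=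
  (((measurable_deriv G).norm.pow_const 2).ennreal_ofReal).indicator isOpen_ball.measurableSet

theorem lintegral_areaDensity {G : ℂ → ℂ} (hG : DifferentiableOn ℂ G (ball 1 1))
    (hinj : InjOn G (ball 1 1)) :
    ∫⁻ z, areaDensity G z = MeasureTheory.volume (G '' ball 1 1) := by
  rw [← MeasureTheory.lintegral_abs_det_fderiv_eq_addHaar_image MeasureTheory.volume
    isOpen_ball.measurableSet (f' := fun z => deriv G z • (1 : ℂ →L[ℝ] ℂ)) (fun z hz =>
      ((hG.differentiableAt (isOpen_ball.mem_nhds hz)).hasDerivAt.complexToReal_fderiv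
        ).hasFDerivWithinAt) hinj, areaDensity,
    MeasureTheory.lintegral_indicator isOpen_ball.measurableSet]
  refine MeasureTheory.lintegral_congr fun z => ?_
  have hdet : (deriv G z • (1 : ℂ →L[ℝ] ℂ)).det = ‖deriv G z‖ ^ 2 := by
    rw [← Complex.normSq_eq_norm_sq, ← Algebra.norm_complex_apply, Algebra.norm_apply]
    rfl
  rw [hdet, abs_of_nonneg (by positivity)]

theorem exists_angle_of_mem_sphere {r : ℝ} (hr : 0 < r) {z : ℂ} (hz : z ∈ sphere (0 : ℂ) r)
    (hz1 : z ∈ ball (1 : ℂ) 1) : ∃ θ ∈ Ioo (-Real.pi) Real.pi, r < 2 * Real.cos θ ∧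
      z = r * (Real.cos θ + Real.sin θ * Complex.I) := by
  have hz2 : z = r * (Real.cos z.arg + Real.sin z.arg * Complex.I) := by
    have := Complex.norm_mul_cos_add_sin_mul_I z
    rw [mem_sphere_zero_iff_norm.1 hz] at this
    push_cast
    exact this.symm
  have hlt : r < 2 * Real.cos z.arg := by
    rwa [← polar_mem_ball_iff hr, ← hz2]
  refine ⟨z.arg, ⟨Complex.neg_pi_lt_arg z, (Complex.arg_le_pi z).lt_of_ne fun h => ?_⟩, hlt, hz2⟩
  rw [h, Real.cos_pi] at hlt
  linarith

theorem ofReal_le_lintegral_areaDensity {G : ℂ → ℂ} (hG : DifferentiableOn ℂ G (ball 1 1))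
    {r δ : ℝ} (hr : 0 < r) (hδ : 0 ≤ δ) {z w : ℂ} (hz : z ∈ sphere (0 : ℂ) r)
    (hz1 : z ∈ ball (1 : ℂ) 1) (hw : w ∈ sphere (0 : ℂ) r) (hw1 : w ∈ ball (1 : ℂ) 1)
    (h : δ ≤ ‖G z - G w‖) :
    ENNReal.ofReal (δ ^ 2 / (2 * Real.pi) * r⁻¹) ≤ ∫⁻ θ in Ioo (-Real.pi) Real.pi,
      ENNReal.ofReal r * areaDensity G (r * (Real.cos θ + Real.sin θ * Complex.I)) := by
  obtain ⟨a, ha, har, rfl⟩ := exists_angle_of_mem_sphere hr hz hz1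
  obtain ⟨b, hb, hbr, rfl⟩ := exists_angle_of_mem_sphere hr hw hw1
  wlog hab : a ≤ b generalizing a b
  · exact this b hb hbr hw hw1 a ha har hz hz1 (by rwa [norm_sub_rev]) (le_of_not_ge hab)
  let e : ℝ → ℂ := fun θ => r * (Real.cos θ + Real.sin θ * Complex.I)
  let e' : ℝ → ℂ := fun θ => r * (-Real.sin θ + Real.cos θ * Complex.I)
  have he : ∀ θ, HasDerivAt e (e' θ) θ := by
    intro θ
    have h1 := (Real.hasDerivAt_cos θ).ofReal_comp
    have h2 := (Real.hasDerivAt_sin θ).ofReal_comp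
    rw [Complex.ofReal_neg] at h1
    exact (h1.add (h2.mul_const Complex.I)).const_mul (r : ℂ)
  have hnorm : ∀ θ, ‖e' θ‖ = r := by
    intro θ
    have h1 : ‖(-Real.sin θ + Real.cos θ * Complex.I : ℂ)‖ = 1 := by
      rw [← pow_eq_one_iff_of_nonneg (norm_nonneg _) two_ne_zero, ← Complex.normSq_eq_norm_sq,
        ← Complex.ofReal_neg, Complex.normSq_add_mul_I]
      nlinarith [Real.sin_sq_add_cos_sq θ]
    simp only [e']
    rw [norm_mul, h1, mul_one, Complex.norm_real, Real.norm_of_nonneg hr.le]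
  have hball : ∀ θ ∈ Icc a b, e θ ∈ ball (1 : ℂ) 1 := by
    intro θ hθ
    refine (polar_mem_ball_iff hr).2 ?_
    rcases le_total 0 θ with h0 | h0
    · have := Real.cos_le_cos_of_nonneg_of_le_pi h0 hb.2.le hθ.2
      linarith
    · have := Real.cos_le_cos_of_nonneg_of_le_pi (neg_nonneg.2 h0)
        (show -a ≤ Real.pi by linarith [ha.1]) (neg_le_neg hθ.1)
      rw [Real.cos_neg, Real.cos_neg] at this
      linarith
  have hcont : ContinuousOn (fun θ => deriv G (e θ) * e' θ) (Icc a b) := by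
    refine ContinuousOn.mul ?_ (by fun_prop)
    exact (hG.deriv isOpen_ball).continuousOn.comp
      (fun θ _ => (he θ).continuousAt.continuousWithinAt) hball
  have key := sq_div_le_integral_norm_sq (c := G ∘ e) (L := 2 * Real.pi) hab
    (by linarith [ha.1, hb.2]) (by positivity) hδ (fun θ hθ =>
      (hG.differentiableAt (isOpen_ball.mem_nhds (hball θ hθ))).hasDerivAt.comp θ (he θ))
    hcont (by rw [norm_sub_rev]; exact h)
  have hsq : ∀ θ, ‖deriv G (e θ) * e' θ‖ ^ 2 = r * (r * ‖deriv G (e θ)‖ ^ 2) := fun θ => by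
    rw [norm_mul, hnorm]
    ring
  simp only [hsq] at key
  rw [intervalIntegral.integral_const_mul] at key
  have hcont2 : ContinuousOn (fun θ => r * ‖deriv G (e θ)‖ ^ 2) (uIcc a b) := by
    rw [uIcc_of_le hab]
    exact continuousOn_const.mul (((hG.deriv isOpen_ball).continuousOn.comp
      (fun θ _ => (he θ).continuousAt.continuousWithinAt) hball).norm.pow 2)
  calc ENNReal.ofReal (δ ^ 2 / (2 * Real.pi) * r⁻¹)
      ≤ ENNReal.ofReal (∫ θ in a..b, r * ‖deriv G (e θ)‖ ^ 2) := by
        refine ENNReal.ofReal_le_ofReal ?_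
        rwa [← div_eq_mul_inv, div_le_iff₀' hr]
    _ = ∫⁻ θ in Ioc a b, ENNReal.ofReal (r * ‖deriv G (e θ)‖ ^ 2) := by
        rw [intervalIntegral.integral_of_le hab,
          MeasureTheory.ofReal_integral_eq_lintegral_ofReal]
        · exact hcont2.intervalIntegrable.1
        · exact Filter.Eventually.of_forall fun θ => by positivity
    _ ≤ ∫⁻ θ in Ioc a b, ENNReal.ofReal r * areaDensity G (e θ) := by
        refine MeasureTheory.setLIntegral_mono' measurableSet_Ioc fun θ hθ => ?_
        rw [areaDensity, indicator_of_mem (hball θ (Ioc_subset_Icc_self hθ)),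
          ENNReal.ofReal_mul hr.le]
    _ ≤ _ := MeasureTheory.lintegral_mono_set fun θ (hθ : θ ∈ Ioc a b) =>
        (⟨ha.1.trans hθ.1, hθ.2.trans_lt hb.2⟩ : θ ∈ Ioo (-Real.pi) Real.pi)

theorem exists_radius_of_injOn {G : ℂ → ℂ} (hG : DifferentiableOn ℂ G (ball 1 1))
    (hinj : InjOn G (ball 1 1)) (hb : Bornology.IsBounded (G '' ball 1 1)) {ρ δ : ℝ} (hρ : 0 < ρ)
    (hδ : 0 < δ) : ∃ r, 0 < r ∧ r < ρ ∧ ∀ z ∈ sphere (0 : ℂ) r ∩ ball 1 1,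
      ∀ w ∈ sphere (0 : ℂ) r ∩ ball 1 1, ‖G z - G w‖ < δ := by
  by_contra! hcon
  have hfin : ∫⁻ z, areaDensity G z ≠ ⊤ := by
    rw [lintegral_areaDensity hG hinj]
    exact hb.measure_lt_top.ne
  have hmeas : Measurable fun p : ℝ × ℝ => ENNReal.ofReal p.1 *
      areaDensity G (p.1 * (Real.cos p.2 + Real.sin p.2 * Complex.I)) := by
    refine measurable_fst.ennreal_ofReal.mul ((measurable_areaDensity G).comp ?_)
    fun_prop
  have hpolar : ∫⁻ r in Ioi (0 : ℝ), ∫⁻ θ in Ioo (-Real.pi) Real.pi, ENNReal.ofReal r *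
      areaDensity G (r * (Real.cos θ + Real.sin θ * Complex.I)) = ∫⁻ z, areaDensity G z := by
    rw [← Complex.lintegral_comp_polarCoord_symm]
    simp only [Complex.polarCoord_symm_apply, smul_eq_mul]
    exact (MeasureTheory.setLIntegral_prod _ hmeas.aemeasurable).symm
  have hlow : ∫⁻ r in Ioo 0 ρ, ENNReal.ofReal (δ ^ 2 / (2 * Real.pi) * r⁻¹) ≤
      ∫⁻ z, areaDensity G z := by
    rw [← hpolar]
    refine (MeasureTheory.setLIntegral_mono' measurableSet_Ioo fun r hr => ?_).trans
      (MeasureTheory.lintegral_mono_set fun r (hr : r ∈ Ioo 0 ρ) => hr.1)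
    obtain ⟨z, hz, w, hw, h⟩ := hcon r hr.1 hr.2
    exact ofReal_le_lintegral_areaDensity hG hr.1 hδ.le hz.1 hz.2 hw.1 hw.2 h
  have h_int : MeasureTheory.IntegrableOn (fun r : ℝ => δ ^ 2 / (2 * Real.pi) * r⁻¹) (Ioo 0 ρ) := by
    refine ⟨(measurable_inv.const_mul _).aestronglyMeasurable, ?_⟩
    rw [MeasureTheory.hasFiniteIntegral_iff_ofReal
      ((MeasureTheory.ae_restrict_iff' measurableSet_Ioo).2 (Filter.Eventually.of_forall
        fun r hr => mul_nonneg (by positivity) (inv_nonneg.2 hr.1.le)))]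
    exact hlow.trans_lt hfin.lt_top
  have hc : δ ^ 2 / (2 * Real.pi) ≠ 0 := by positivity
  have hint2 : MeasureTheory.IntegrableOn (fun r : ℝ => r⁻¹) (Ioo 0 ρ) := by
    have := h_int.const_mul (δ ^ 2 / (2 * Real.pi))⁻¹
    simp only [inv_mul_cancel_left₀ hc] at this
    exact this
  have := (intervalIntegrable_iff_integrableOn_Ioo_of_le hρ.le).2 hint2
  rw [intervalIntegrable_inv_iff] at this
  rcases this with h | h
  · exact hρ.ne h
  · exact h left_mem_uIcc

/-- Wolff's lemma: a bounded conformal map of the disk has arbitrarily small crosscuts around a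
boundary point with arbitrarily small images. -/
theorem exists_radius_norm_sub_lt {g : ℂ → ℂ} (hg : DifferentiableOn ℂ g (ball 0 1))
    (hinj : InjOn g (ball 0 1)) (hb : Bornology.IsBounded (g '' ball 0 1)) {ζ : ℂ} (hζ : ‖ζ‖ = 1)
    {ρ δ : ℝ} (hρ : 0 < ρ) (hδ : 0 < δ) : ∃ r, 0 < r ∧ r < ρ ∧ ∀ z ∈ sphere ζ r ∩ ball 0 1,
      ∀ w ∈ sphere ζ r ∩ ball 0 1, ‖g z - g w‖ < δ := by
  have hζ0 : ζ ≠ 0 := norm_ne_zero_iff.1 (by rw [hζ]; exact one_ne_zero)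
  have hmaps : MapsTo (fun u : ℂ => ζ * (1 - u)) (ball 1 1) (ball 0 1) := by
    intro u hu
    rw [mem_ball, dist_eq_norm] at hu
    rwa [mem_ball_zero_iff, norm_mul, hζ, one_mul, norm_sub_rev]
  obtain ⟨r, hr, hrρ, h⟩ := exists_radius_of_injOn (G := fun u => g (ζ * (1 - u)))
    (hg.comp (by fun_prop) hmaps) (fun u hu v hv huv => by
      simpa [hζ0] using hinj (hmaps hu) (hmaps hv) huv)
    (hb.subset (by rintro _ ⟨u, hu, rfl⟩; exact mem_image_of_mem g (hmaps hu))) hρ hδ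
  have hback : ∀ z ∈ sphere ζ r ∩ ball 0 1,
      1 - ζ⁻¹ * z ∈ sphere (0 : ℂ) r ∩ ball 1 1 ∧ ζ * (1 - (1 - ζ⁻¹ * z)) = z := by
    rintro z ⟨hz1, hz2⟩
    refine ⟨⟨?_, ?_⟩, by field_simp; ring⟩
    · rw [mem_sphere_zero_iff_norm, ← mem_sphere_iff_norm.1 hz1, norm_sub_rev z ζ,
        show ζ - z = ζ * (1 - ζ⁻¹ * z) by field_simp, norm_mul, hζ, one_mul]
    · rw [mem_ball, dist_eq_norm, sub_sub_cancel_left, norm_neg, norm_mul, norm_inv, hζ, inv_one,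
        one_mul]
      simpa using hz2
  refine ⟨r, hr, hrρ, fun z hz w hw => ?_⟩
  have := h _ (hback z hz).1 _ (hback w hw).1
  simp only [(hback z hz).2, (hback w hw).2] at this
  exact this

/-! ### Boundary behaviour of the Riemann map -/

theorem HasLogOn.mem_connectedComponentIn_union {Z A : Set ℂ} {x y : ℂ} (hZ : IsClosed Z)
    (hA : IsClosed A) (hb : Bornology.IsBounded Zᶜ) (hZA : IsPreconnected (Z ∩ A))
    (hlZ : HasLogOn (fun z => (z - x) / (z - y)) Z) (hlA : HasLogOn (fun z => (z - x) / (z - y)) A)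
    (hx : x ∉ Z ∪ A) (hy : y ∉ Z ∪ A) : y ∈ connectedComponentIn (Z ∪ A)ᶜ x :=
  (hlZ.union hlA hZ hA hZA).mem_connectedComponentIn (hZ.union hA) hx hy
    (hb.subset ((connectedComponentIn_subset _ _).trans (compl_subset_compl.2 subset_union_left)))

theorem hasLogOn_div_closedBall {c x y : ℂ} {r : ℝ} (hr : 0 < r) (hx : x ∉ closedBall c r)
    (hy : y ∉ closedBall c r) : HasLogOn (fun z => (z - x) / (z - y)) (closedBall c r) := by
  have hne : ∀ x ∉ closedBall c r, ∀ z ∈ closedBall c r, z - x ≠ 0 := fun x hx z hz h =>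
    hx (sub_eq_zero.1 h ▸ hz)
  exact hasLogOn_closedBall hr (ContinuousOn.div (by fun_prop) (by fun_prop) (hne y hy))
    fun z hz => div_ne_zero (hne x hx z hz) (hne y hy z hz)

theorem LocallyConnectedAtBoundary.exists_isClosed_isPreconnected {W K : Set ℂ}
    (hW : LocallyConnectedAtBoundary W) (hK : IsCompact K) {ε : ℝ} (hε : 0 < ε) :
    ∃ δ > 0, ∀ a ∈ K, ∃ B, IsClosed B ∧ IsPreconnected B ∧ closure W ∩ ball a δ ⊆ B ∧
      B ⊆ closure W ∩ closedBall a ε := by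
  choose δ hδ S hS hWS hSW using fun p => hW p (ε / 2) (half_pos hε)
  obtain ⟨η, hη, h⟩ := lebesgue_number_lemma_of_metric hK
    (c := fun p => ball p (min (δ p) (ε / 2))) (fun p => isOpen_ball)
    (fun p _ => mem_iUnion.2 ⟨p, mem_ball_self (lt_min (hδ p) (half_pos hε))⟩)
  refine ⟨η, hη, fun a ha => ?_⟩
  obtain ⟨p, hp⟩ := h a ha
  have hap : dist a p < ε / 2 := (hp (mem_ball_self hη)).trans_le (min_le_right _ _)
  refine ⟨closure (S p), isClosed_closure, (hS p).closure, ?_, fun z hz => ⟨?_, ?_⟩⟩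
  · refine isOpen_ball.closure_inter.trans (closure_mono (Subset.trans ?_ (hWS p)))
    exact inter_subset_inter_right _ (hp.trans (ball_subset_ball (min_le_left _ _)))
  · exact closure_mono ((hSW p).trans inter_subset_left) hz
  · have h1 : z ∈ closedBall p (ε / 2) :=
      closure_minimal ((hSW p).trans (inter_subset_right.trans ball_subset_closedBall))
        isClosed_closedBall hz
    rw [mem_closedBall] at h1 ⊢
    linarith [dist_triangle z p a, dist_comm a p]

theorem closure_image_crosscut_inter_nonempty {D : Set ℂ} {f g : ℂ → ℂ} (h : IsRiemannMap D f g)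
    (hDb : Bornology.IsBounded D) {ζ : ℂ} (hζ : ‖ζ‖ = 1) {r : ℝ} (hr : 0 < r) (hr1 : r < 1) :
    (closure (g '' (sphere ζ r ∩ ball 0 1)) ∩ Dᶜ).Nonempty := by
  by_contra hne
  rw [not_nonempty_iff_eq_empty, ← disjoint_iff_inter_eq_empty, disjoint_compl_right_iff_subset]
    at hne
  set γ := sphere ζ r ∩ ball (0 : ℂ) 1 with hγ
  have hγD : g '' γ ⊆ D := (h.mapsTo.mono_left inter_subset_right).image_subset
  have hc : IsCompact (closure (g '' γ)) := (hDb.subset hγD).isCompact_closure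
  have hin : ((1 - r : ℝ) : ℂ) * ζ ∈ γ := by
    refine ⟨?_, ?_⟩
    · rw [mem_sphere_iff_norm, show ((1 - r : ℝ) : ℂ) * ζ - ζ = -(r * ζ) by push_cast; ring,
        norm_neg, norm_mul, hζ, mul_one, Complex.norm_real, Real.norm_of_nonneg hr.le]
    · rw [mem_ball_zero_iff, norm_mul, hζ, mul_one, Complex.norm_real,
        Real.norm_of_nonneg (by linarith)]
      linarith
  have hout : ((1 + r : ℝ) : ℂ) * ζ ∈ sphere ζ r ∧ 1 < ‖((1 + r : ℝ) : ℂ) * ζ‖ := by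
    refine ⟨?_, ?_⟩
    · rw [mem_sphere_iff_norm, show ((1 + r : ℝ) : ℂ) * ζ - ζ = r * ζ by push_cast; ring,
        norm_mul, hζ, mul_one, Complex.norm_real, Real.norm_of_nonneg hr.le]
    · rw [norm_mul, hζ, mul_one, Complex.norm_real, Real.norm_of_nonneg (by linarith)]
      linarith
  have hfc : IsCompact (f '' closure (g '' γ)) :=
    hc.image_of_continuousOn (h.diff_inv.continuousOn.mono hne)
  have hγf : γ ⊆ f '' closure (g '' γ) := fun z hz =>
    ⟨g z, subset_closure (mem_image_of_mem g hz), h.left_inv z hz.2⟩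
  have hf1 : f '' closure (g '' γ) ⊆ ball 0 1 := by
    rintro _ ⟨z, hz, rfl⟩
    exact h.mapsTo_inv (hne hz)
  obtain ⟨z, hz, hz1, hz2⟩ := isPreconnected_sphere (E := ℂ)
    (by rw [Complex.rank_real_complex]; exact Cardinal.one_lt_two) ζ r (ball 0 1)
    (f '' closure (g '' γ))ᶜ isOpen_ball hfc.isClosed.isOpen_compl
    (fun z hz => by
      by_cases hz1 : z ∈ ball (0 : ℂ) 1
      · exact Or.inl hz1
      · exact Or.inr fun h => hz1 (hf1 h))
    ⟨_, hin⟩ ⟨_, hout.1, fun h => hout.2.not_gt (by simpa using hf1 h)⟩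
  exact hz2 (hγf ⟨hz, hz1⟩)

theorem exists_radius_dist_le {D W : Set ℂ} {f g : ℂ → ℂ} (h : IsRiemannMap D f g)
    (hDo : IsOpen D) (hD : IsPreconnected D) (hDb : Bornology.IsBounded D) (hDW : Dᶜ = closure W)
    (hW : LocallyConnectedAtBoundary W) {ζ : ℂ} (hζ : ‖ζ‖ = 1) {ε : ℝ} (hε : 0 < ε) :
    ∃ r > 0, ∃ a, ∀ x ∈ ball ζ r ∩ ball 0 1, dist (g x) a ≤ ε := by
  have h0 : (0 : ℂ) ∈ ball (0 : ℂ) 1 := mem_ball_self one_pos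
  have hinj : InjOn g (ball 0 1) := LeftInvOn.injOn h.left_inv
  obtain ⟨η, hη, hηD⟩ := Metric.isOpen_iff.1 hDo (g 0) (h.mapsTo h0)
  set ε' := min ε (η / 2) with hε'
  have hε'0 : 0 < ε' := lt_min hε (half_pos hη)
  obtain ⟨δ, hδ, hB⟩ := hW.exists_isClosed_isPreconnected hDb.isCompact_closure hε'0
  set δ' := min (δ / 2) ε' with hδ'
  have hδ'0 : 0 < δ' := lt_min (half_pos hδ) hε'0
  obtain ⟨r, hr, hr1, hosc⟩ := exists_radius_norm_sub_lt h.diff hinj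
    (hDb.subset h.mapsTo.image_subset) hζ one_pos hδ'0
  set γ := sphere ζ r ∩ ball (0 : ℂ) 1 with hγ
  set Γ := closure (g '' γ) with hΓ
  obtain ⟨a, haΓ, haD⟩ := closure_image_crosscut_inter_nonempty h hDb hζ hr hr1
  have hΓD : Γ ⊆ closure D :=
    closure_mono (h.mapsTo.mono_left inter_subset_right).image_subset
  obtain ⟨B, hBc, hBp, hB1, hB2⟩ := hB a (hΓD haΓ)
  have hΓa : Γ ⊆ closedBall a δ' := by
    refine closure_minimal ?_ isClosed_closedBall
    rintro _ ⟨z, hz, rfl⟩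
    rw [mem_closedBall']
    suffices Γ ⊆ closedBall (g z) δ' from this haΓ
    refine closure_minimal ?_ isClosed_closedBall
    rintro _ ⟨w, hw, rfl⟩
    rw [mem_closedBall, dist_eq_norm]
    exact (hosc w hw z hz).le
  have hAball : Γ ∪ B ⊆ closedBall a ε' :=
    union_subset (hΓa.trans (closedBall_subset_closedBall (min_le_right _ _)))
      (hB2.trans inter_subset_right)
  have hZA : Dᶜ ∩ (Γ ∪ B) = B := by
    refine Subset.antisymm ?_ fun z hz => ⟨by rw [hDW]; exact (hB2 hz).1, Or.inr hz⟩
    rintro z ⟨hz, hz1 | hz1⟩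
    · refine hB1 ⟨hDW ▸ hz, ?_⟩
      have h1 : dist z a ≤ δ' := hΓa hz1
      have h2 : δ' ≤ δ / 2 := min_le_left _ _
      rw [mem_ball]
      linarith
    · exact hz1
  have hy : g 0 ∉ closedBall a ε' := by
    intro hy
    refine haD (hηD ?_)
    rw [mem_closedBall'] at hy
    have h1 : ε' ≤ η / 2 := min_le_right _ _
    rw [mem_ball]
    linarith
  refine ⟨r, hr, a, fun x hx => ?_⟩
  by_contra! hxa
  have hx' : g x ∉ closedBall a ε' := fun h1 =>
    absurd hxa (not_lt.2 ((mem_closedBall.1 h1).trans (min_le_left _ _)))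
  have hxD := h.mapsTo hx.2
  have hmem := HasLogOn.mem_connectedComponentIn_union (A := Γ ∪ B) hDo.isClosed_compl
    (isClosed_closure.union hBc) (by rwa [compl_compl]) (by rwa [hZA])
    (hasLogOn_of_isPreconnected hDo.isClosed_compl hD (by rw [compl_compl]) hxD (h.mapsTo h0))
    ((hasLogOn_div_closedBall hε'0 hx' hy).mono hAball)
    (fun h1 => h1.elim (fun h2 => h2 hxD) fun h2 => hx' (hAball h2))
    (fun h1 => h1.elim (fun h2 => h2 (h.mapsTo h0)) fun h2 => hy (hAball h2))
  set C := connectedComponentIn (Dᶜ ∪ (Γ ∪ B))ᶜ (g x) with hC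
  have hCsub : C ⊆ (Dᶜ ∪ (Γ ∪ B))ᶜ := connectedComponentIn_subset _ _
  have hCD : C ⊆ D := fun z hz => by
    by_contra h1
    exact hCsub hz (Or.inl h1)
  have hxC : g x ∈ C := mem_connectedComponentIn (fun h1 =>
    h1.elim (fun h2 => h2 hxD) fun h2 => hx' (hAball h2))
  obtain ⟨_, ⟨v, hv, rfl⟩, hvr⟩ := (isPreconnected_connectedComponentIn.image f
    (h.diff_inv.continuousOn.mono hCD)).intermediate_value₂ (f := fun z => dist z ζ)
    (g := fun _ => r) (mem_image_of_mem f hxC) (mem_image_of_mem f hmem) (by fun_prop)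
    (by fun_prop) (by rw [h.left_inv x hx.2]; exact (mem_ball.1 hx.1).le)
    (by rw [h.left_inv 0 h0, dist_zero_left, hζ]; exact hr1.le)
  refine hCsub hv (Or.inr (Or.inl (subset_closure ⟨f v, ⟨hvr, h.mapsTo_inv (hCD hv)⟩, ?_⟩)))
  exact h.right_inv v (hCD hv)

/-- Carathéodory's theorem: continuous extension of the Riemann map. -/
theorem IsRiemannMap.exists_continuousOn_closedBall {D W : Set ℂ} {f g : ℂ → ℂ}
    (h : IsRiemannMap D f g) (hDo : IsOpen D) (hD : IsPreconnected D)
    (hDb : Bornology.IsBounded D) (hDW : Dᶜ = closure W) (hW : LocallyConnectedAtBoundary W) :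
    ∃ G, ContinuousOn G (closedBall 0 1) ∧ EqOn G g (ball 0 1) ∧
      MapsTo G (sphere 0 1) Dᶜ := by
  have hcl : closure (ball (0 : ℂ) 1) = closedBall 0 1 := closure_ball 0 one_ne_zero
  have hG : ContinuousOn (extendFrom (ball 0 1) g) (closedBall 0 1) := by
    refine continuousOn_extendFrom hcl.ge fun ζ hζ => ?_
    have hne : (nhdsWithin ζ (ball 0 1)).NeBot := mem_closure_iff_nhdsWithin_neBot.1 (hcl.ge hζ)
    rcases (mem_closedBall_zero_iff.1 hζ).lt_or_eq with hlt | heq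
    · exact ⟨g ζ, h.diff.continuousOn ζ (mem_ball_zero_iff.2 hlt)⟩
    rw [← cauchy_map_iff_exists_tendsto, Metric.cauchy_iff]
    refine ⟨hne.map g, fun ε hε => ?_⟩
    obtain ⟨r, hr, a, ha⟩ := exists_radius_dist_le h hDo hD hDb hDW hW heq (ε := ε / 3)
      (by positivity)
    refine ⟨g '' (ball ζ r ∩ ball 0 1), Filter.image_mem_map
      (Filter.inter_mem
      (mem_nhdsWithin_of_mem_nhds (ball_mem_nhds ζ hr)) self_mem_nhdsWithin), ?_⟩
    rintro _ ⟨x, hx, rfl⟩ _ ⟨y, hy, rfl⟩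
    linarith [dist_triangle_right (g x) (g y) a, ha x hx, ha y hy]
  have hGg : EqOn (extendFrom (ball 0 1) g) g (ball 0 1) :=
    extendFrom_extends h.diff.continuousOn
  refine ⟨_, hG, hGg, fun ζ hζ hζD => ?_⟩
  have hζc : ζ ∈ closedBall (0 : ℂ) 1 := sphere_subset_closedBall hζ
  have hne : (nhdsWithin ζ (ball 0 1)).NeBot := mem_closure_iff_nhdsWithin_neBot.1 (hcl.ge hζc)
  have h1 : Filter.Tendsto (fun z => f (extendFrom (ball 0 1) g z)) (nhdsWithin ζ (ball 0 1))
      (nhds (f (extendFrom (ball 0 1) g ζ))) :=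
    ((h.diff_inv.differentiableAt (hDo.mem_nhds hζD)).continuousAt.tendsto).comp
      ((hG ζ hζc).mono_left (nhdsWithin_mono ζ ball_subset_closedBall))
  have h2 : Filter.Tendsto (fun z => f (extendFrom (ball 0 1) g z)) (nhdsWithin ζ (ball 0 1))
      (nhds ζ) := by
    refine (Filter.tendsto_id.mono_left nhdsWithin_le_nhds).congr' ?_
    filter_upwards [self_mem_nhdsWithin] with z hz
    rw [hGg hz, h.left_inv z hz, id]
  have h3 := h.mapsTo_inv hζD
  rw [tendsto_nhds_unique h1 h2, mem_ball_zero_iff, mem_sphere_zero_iff_norm.1 hζ] at h3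
  exact lt_irrefl _ h3

/-! ### Injectivity on the circle -/

theorem eq_of_forall_sphere_inter_eq {G : ℂ → ℂ} {p : ℂ} {U : Set ℂ}
    (hG : ContinuousOn G (closedBall 0 1)) (hd : DifferentiableOn ℂ G (ball 0 1))
    (hU : IsOpen U) (hne : (sphere (0 : ℂ) 1 ∩ U).Nonempty)
    (h : ∀ z ∈ sphere (0 : ℂ) 1 ∩ U, G z = p) : G 0 = p := by
  obtain ⟨w, hw, hwU⟩ := hne
  have hn : ∀ c : sphere (0 : ℂ) 1, ‖(c : ℂ)‖ = 1 := fun c => mem_sphere_zero_iff_norm.1 c.2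
  obtain ⟨t, ht⟩ := (isCompact_sphere (0 : ℂ) 1).elim_finite_subcover
    (fun c : sphere (0 : ℂ) 1 => (fun z : ℂ => (c : ℂ) * z) ⁻¹' U)
    (fun c => hU.preimage (by fun_prop)) (fun z hz => by
      rw [mem_sphere_zero_iff_norm] at hz hw
      refine mem_iUnion.2 ⟨⟨w * (starRingEnd ℂ) z, ?_⟩, ?_⟩
      · rw [mem_sphere_zero_iff_norm, norm_mul, RCLike.norm_conj, hz, hw, one_mul]
      · rw [mem_preimage, mul_assoc, Complex.conj_mul', hz]
        simpa using hwU)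
  have hcl : closure (ball (0 : ℂ) 1) = closedBall 0 1 := closure_ball 0 one_ne_zero
  have hF : DiffContOnCl ℂ (fun z => ∏ c ∈ t, (G ((c : ℂ) * z) - p)) (ball 0 1) := by
    refine ⟨DifferentiableOn.fun_finsetProd fun c _ => ?_,
      continuousOn_finsetProd _ fun c _ => ?_⟩
    · refine (hd.comp (by fun_prop) fun z hz => ?_).sub_const p
      rwa [mem_ball_zero_iff, norm_mul, hn, one_mul, ← mem_ball_zero_iff]
    · rw [hcl]
      refine (hG.comp (by fun_prop) fun z hz => ?_).sub continuousOn_const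
      rwa [mem_closedBall_zero_iff, norm_mul, hn, one_mul, ← mem_closedBall_zero_iff]
  have h0 := Complex.norm_le_of_forall_mem_frontier_norm_le isBounded_ball hF (C := 0)
    (fun z hz => by
      rw [frontier_ball 0 one_ne_zero] at hz
      obtain ⟨c, hc, hcz⟩ := mem_iUnion₂.1 (ht hz)
      rw [Finset.prod_eq_zero hc, norm_zero]
      refine sub_eq_zero.2 (h _ ⟨?_, hcz⟩)
      rwa [mem_sphere_zero_iff_norm, norm_mul, hn, one_mul, ← mem_sphere_zero_iff_norm])
    (subset_closure (mem_ball_self one_pos))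
  obtain ⟨c, -, hc⟩ := Finset.prod_eq_zero_iff.1 (norm_le_zero_iff.1 h0)
  rw [mul_zero] at hc
  exact sub_eq_zero.1 hc

theorem eq_or_eq_of_im_conj_mul_eq_zero {a b z : ℂ} (hab : a ≠ b) (ha : ‖a‖ = 1) (hb : ‖b‖ = 1)
    (hz : ‖z‖ = 1) (h : ((starRingEnd ℂ) (b - a) * (z - a)).im = 0) : z = a ∨ z = b := by
  have key : ∀ w : ℂ, ‖w‖ = 1 → w.re * w.re + w.im * w.im = 1 := fun w hw => by
    rw [← Complex.normSq_apply, Complex.normSq_eq_norm_sq, hw, one_pow]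
  have h1 := key a ha
  have h2 := key b hb
  have h3 := key z hz
  simp only [Complex.mul_im, Complex.conj_re, Complex.conj_im, Complex.sub_re, Complex.sub_im] at h
  set u := b.re - a.re with hu
  set v := b.im - a.im with hv
  have hd : 0 < u ^ 2 + v ^ 2 := by
    by_contra! hle
    refine hab (Complex.ext ?_ ?_) <;> nlinarith [sq_nonneg u, sq_nonneg v]
  set t := (u * (z.re - a.re) + v * (z.im - a.im)) / (u ^ 2 + v ^ 2) with ht
  have hx : z.re - a.re = t * u := by
    rw [ht]; field_simp; linear_combination (-v) * h
  have hy : z.im - a.im = t * v := by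
    rw [ht]; field_simp; linear_combination u * h
  have hq : t * (t - 1) * (u ^ 2 + v ^ 2) = 0 := by
    have e1 : z.re = a.re + t * u := by linarith
    have e2 : z.im = a.im + t * v := by linarith
    have e3 : b.re = a.re + u := by rw [hu]; ring
    have e4 : b.im = a.im + v := by rw [hv]; ring
    rw [e1, e2] at h3
    rw [e3, e4] at h2
    linear_combination h3 - t * h2 - (1 - t) * h1
  rcases mul_eq_zero.1 ((mul_eq_zero.1 hq).resolve_right hd.ne') with h0 | h0
  · left
    rw [h0] at hx hy
    exact Complex.ext (by linarith) (by linarith)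
  · right
    rw [sub_eq_zero.1 h0] at hx hy
    exact Complex.ext (by linarith) (by linarith)

theorem exists_im_conj_mul_pos {a b : ℂ} (hab : a ≠ b) (ha : ‖a‖ = 1) (hb : ‖b‖ = 1) :
    (∃ z ∈ sphere (0 : ℂ) 1, 0 < ((starRingEnd ℂ) (b - a) * (z - a)).im) ∧
      ∃ z ∈ sphere (0 : ℂ) 1, ((starRingEnd ℂ) (b - a) * (z - a)).im < 0 := by
  have hd : 0 < ‖b - a‖ := norm_pos_iff.2 (sub_ne_zero.2 hab.symm)
  set m := (starRingEnd ℂ) (b - a) * a with hm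
  have hmn : ‖m‖ = ‖b - a‖ := by rw [hm, norm_mul, RCLike.norm_conj, ha, mul_one]
  have hre : m.re ≠ 0 := by
    have key : ∀ w : ℂ, ‖w‖ = 1 → w.re * w.re + w.im * w.im = 1 := fun w hw => by
      rw [← Complex.normSq_apply, Complex.normSq_eq_norm_sq, hw, one_pow]
    have h1 := key a ha
    have h2 := key b hb
    intro h0
    simp only [hm, Complex.mul_re, Complex.conj_re, Complex.conj_im, Complex.sub_re,
      Complex.sub_im] at h0
    refine hab (Complex.ext ?_ ?_) <;>
      nlinarith [sq_nonneg (b.re - a.re), sq_nonneg (b.im - a.im)]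
  have him : |m.im| < ‖b - a‖ := by
    rw [← hmn]
    exact Complex.abs_im_lt_norm.2 hre
  rw [abs_lt] at him
  set w := Complex.I * ((b - a) / (‖b - a‖ : ℂ)) with hw
  have hwn : ‖w‖ = 1 := by
    rw [hw, norm_mul, Complex.norm_I, one_mul, norm_div, Complex.norm_real, norm_norm,
      div_self hd.ne']
  have hwm : (starRingEnd ℂ) (b - a) * w = Complex.I * (‖b - a‖ : ℂ) := by
    have hd' : (‖b - a‖ : ℂ) ≠ 0 := Complex.ofReal_ne_zero.2 hd.ne'
    rw [hw, mul_left_comm, ← mul_div_assoc, Complex.conj_mul', sq, mul_div_cancel_right₀ _ hd']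
  refine ⟨⟨w, mem_sphere_zero_iff_norm.2 hwn, ?_⟩,
    ⟨-w, mem_sphere_zero_iff_norm.2 (by rwa [norm_neg]), ?_⟩⟩
  · rw [mul_sub, hwm, ← hm]
    simp
    linarith
  · rw [mul_sub, mul_neg, hwm, ← hm]
    simp
    linarith

theorem IsRiemannMap.eq_or_eq_of_eq {D W : Set ℂ} {f g G : ℂ → ℂ} (h : IsRiemannMap D f g)
    (hDo : IsOpen D) (hD : IsPreconnected D) (hDb : Bornology.IsBounded D)
    (hWo : IsOpen W) (hWc : IsPreconnected W) (hDW : Dᶜ = closure W)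
    (hG : ContinuousOn G (closedBall 0 1)) (hGg : EqOn G g (ball 0 1))
    (hGs : MapsTo G (sphere 0 1) Dᶜ) {a b x y : ℂ} (ha : ‖a‖ = 1) (hb : ‖b‖ = 1) (hab : a ≠ b)
    (hGab : G a = G b) (hx : x ∈ sphere (0 : ℂ) 1) (hy : y ∈ sphere (0 : ℂ) 1)
    (hxl : ((starRingEnd ℂ) (b - a) * (x - a)).im < 0)
    (hyl : 0 < ((starRingEnd ℂ) (b - a) * (y - a)).im) : G x = G a ∨ G y = G a := by
  by_contra! hne
  set l : ℂ → ℝ := fun z => ((starRingEnd ℂ) (b - a) * (z - a)).im with hl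
  have hlc : Continuous l := by fun_prop
  have hcl : closure (ball (0 : ℂ) 1) = closedBall 0 1 := closure_ball 0 one_ne_zero
  set A := closedBall (0 : ℂ) 1 ∩ l ⁻¹' {0} with hA
  have hJc : IsCompact (G '' A) :=
    ((isCompact_closedBall 0 1).inter_right (isClosed_singleton.preimage hlc)).image_of_continuousOn
      (hG.mono inter_subset_left)
  have hJ : ∀ z ∈ A, G z ∈ D ∨ G z = G a := by
    rintro z ⟨hz, hlz⟩
    rcases (mem_closedBall_zero_iff.1 hz).lt_or_eq with hlt | heq
    · left
      rw [hGg (mem_ball_zero_iff.2 hlt)]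
      exact h.mapsTo (mem_ball_zero_iff.2 hlt)
    · right
      rcases eq_or_eq_of_im_conj_mul_eq_zero hab ha hb heq hlz with rfl | rfl
      exacts [rfl, hGab.symm]
  have haA : a ∈ A := ⟨mem_closedBall_zero_iff.2 ha.le, by simp [hl]⟩
  have hZA : Dᶜ ∩ G '' A = {G a} := by
    refine Subset.antisymm ?_ (singleton_subset_iff.2
      ⟨hGs (mem_sphere_zero_iff_norm.2 ha), mem_image_of_mem G haA⟩)
    rintro _ ⟨hzD, z, hz, rfl⟩
    exact (hJ z hz).resolve_left hzD
  have hbd : ∀ z ∈ sphere (0 : ℂ) 1, G z ∈ closure D := fun z hz => by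
    have hz1 : z ∈ closure (ball (0 : ℂ) 1) := hcl.ge (sphere_subset_closedBall hz)
    have h1 := (hG z (hcl.le hz1)).mono ball_subset_closedBall
    have h2 := h1.mem_closure_image hz1
    refine closure_mono ?_ h2
    rintro _ ⟨w, hw, rfl⟩
    rw [hGg hw]
    exact h.mapsTo hw
  have hWD : Disjoint W D := by
    rw [← subset_compl_iff_disjoint_right, hDW]
    exact subset_closure
  have haW : G a ∉ W := fun h1 => by
    obtain ⟨z, hzW, hzD⟩ :=
      _root_.mem_closure_iff.1 (hbd a (mem_sphere_zero_iff_norm.2 ha)) W hWo h1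
    exact disjoint_left.1 hWD hzW hzD
  have hWJ : W ⊆ (G '' A)ᶜ := by
    rintro _ hzW ⟨z, hz, rfl⟩
    rcases hJ z hz with h1 | h1
    · exact disjoint_left.1 hWD hzW h1
    · exact haW (h1 ▸ hzW)
  have key : ∀ z ∈ sphere (0 : ℂ) 1, G z ≠ G a → ∀ O : Set ℂ, IsOpen O → z ∈ O →
      ∃ S, IsPreconnected S ∧ W ⊆ S ∧ S ⊆ (G '' A)ᶜ ∧ ∃ w ∈ ball (0 : ℂ) 1, w ∈ O ∧ g w ∈ S := by
    intro z hz hza O hO hzO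
    have hzc := hGs hz
    have hzJ : G z ∈ (G '' A)ᶜ := fun h1 => hza (hZA.le ⟨hzc, h1⟩)
    obtain ⟨η, hη, hηJ⟩ := Metric.isOpen_iff.1 hJc.isClosed.isOpen_compl _ hzJ
    have hz1 : z ∈ closure (ball (0 : ℂ) 1) := hcl.ge (sphere_subset_closedBall hz)
    have hnb : (nhdsWithin z (ball 0 1)).NeBot := mem_closure_iff_nhdsWithin_neBot.1 hz1
    have h1 : ContinuousWithinAt G (ball 0 1) z := (hG z (hcl.le hz1)).mono ball_subset_closedBall
    have h2 : ∀ᶠ w in nhdsWithin z (ball 0 1), G w ∈ ball (G z) η :=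
      h1.tendsto.eventually_mem (ball_mem_nhds (G z) hη)
    have h3 : ∀ᶠ w in nhdsWithin z (ball 0 1), w ∈ O :=
      mem_nhdsWithin_of_mem_nhds (hO.mem_nhds hzO)
    obtain ⟨w, ⟨hw1, hw2⟩, hw3⟩ := ((h2.and h3).and self_mem_nhdsWithin).exists
    rw [hDW, _root_.mem_closure_iff] at hzc
    obtain ⟨q, hq1, hq2⟩ := hzc _ isOpen_ball (mem_ball_self hη)
    refine ⟨W ∪ ball (G z) η, hWc.union q hq2 hq1 (convex_ball _ _).isPreconnected,
      subset_union_left, union_subset hWJ hηJ, w, hw3, hw2, Or.inr ?_⟩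
    rw [← hGg hw3]
    exact hw1
  obtain ⟨S, hS, hWS, hSJ, u, hu, hul, huS⟩ := key x hx hne.1 _
    (isOpen_Iio.preimage hlc) (mem_preimage.2 (mem_Iio.2 hxl))
  obtain ⟨T, hT, hWT, hTJ, v, hv, hvl, hvT⟩ := key y hy hne.2 _
    (isOpen_Ioi.preimage hlc) (mem_preimage.2 (mem_Ioi.2 hyl))
  obtain ⟨q, hq⟩ : W.Nonempty := by
    rw [← closure_nonempty_iff, ← hDW]
    exact ⟨_, hGs hx⟩
  have huD := h.mapsTo hu
  have hvD := h.mapsTo hv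
  have hu' : g u ∉ Dᶜ ∪ G '' A := fun h1 => h1.elim (fun h2 => h2 huD) fun h2 => hSJ huS h2
  have hv' : g v ∉ Dᶜ ∪ G '' A := fun h1 => h1.elim (fun h2 => h2 hvD) fun h2 => hTJ hvT h2
  have hmem := HasLogOn.mem_connectedComponentIn_union hDo.isClosed_compl hJc.isClosed
    (by rwa [compl_compl]) (by rw [hZA]; exact isPreconnected_singleton)
    (hasLogOn_of_isPreconnected hDo.isClosed_compl hD (by rw [compl_compl]) huD hvD)
    (hasLogOn_of_isPreconnected hJc.isClosed (hS.union q (hWS hq) (hWT hq) hT)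
      (union_subset hSJ hTJ) (Or.inl huS) (Or.inr hvT)) hu' hv'
  set C := connectedComponentIn (Dᶜ ∪ G '' A)ᶜ (g u) with hC
  have hCsub : C ⊆ (Dᶜ ∪ G '' A)ᶜ := connectedComponentIn_subset _ _
  have hCD : C ⊆ D := fun z hz => by
    by_contra h1
    exact hCsub hz (Or.inl h1)
  obtain ⟨_, ⟨z, hz, rfl⟩, hlz⟩ := (isPreconnected_connectedComponentIn.image f
    (h.diff_inv.continuousOn.mono hCD)).intermediate_value₂ (f := l) (g := fun _ => 0)
    (mem_image_of_mem f (mem_connectedComponentIn hu')) (mem_image_of_mem f hmem)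
    hlc.continuousOn continuousOn_const (by rw [h.left_inv u hu]; exact (mem_Iio.1 hul).le)
    (by rw [h.left_inv v hv]; exact (mem_Ioi.1 hvl).le)
  have hfz := h.mapsTo_inv (hCD hz)
  refine hCsub hz (Or.inr ⟨f z, ⟨ball_subset_closedBall hfz, hlz⟩, ?_⟩)
  rw [hGg hfz, h.right_inv z (hCD hz)]

theorem IsRiemannMap.injOn_closedBall {D W : Set ℂ} {f g G : ℂ → ℂ} (h : IsRiemannMap D f g)
    (hDo : IsOpen D) (hD : IsPreconnected D) (hDb : Bornology.IsBounded D)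
    (hWo : IsOpen W) (hWc : IsPreconnected W) (hDW : Dᶜ = closure W)
    (hG : ContinuousOn G (closedBall 0 1)) (hGg : EqOn G g (ball 0 1))
    (hGs : MapsTo G (sphere 0 1) Dᶜ) : InjOn G (closedBall 0 1) := by
  have hGb : ∀ z ∈ ball (0 : ℂ) 1, G z ∈ D := fun z hz => by
    rw [hGg hz]
    exact h.mapsTo hz
  have hsph : ∀ a ∈ sphere (0 : ℂ) 1, ∀ b ∈ sphere (0 : ℂ) 1, G a = G b → a = b := by
    intro a ha b hb hGab
    by_contra hab
    have ha1 := mem_sphere_zero_iff_norm.1 ha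
    have hb1 := mem_sphere_zero_iff_norm.1 hb
    have hlc : Continuous fun z : ℂ => ((starRingEnd ℂ) (b - a) * (z - a)).im := by fun_prop
    have hd : DifferentiableOn ℂ G (ball 0 1) := h.diff.congr hGg
    have h0 : G 0 ≠ G a := fun h1 => hGs ha (h1 ▸ hGb 0 (mem_ball_self one_pos))
    obtain ⟨⟨y, hy, hyl⟩, ⟨x, hx, hxl⟩⟩ := exists_im_conj_mul_pos hab ha1 hb1
    by_cases hxa : ∃ x ∈ sphere (0 : ℂ) 1, ((starRingEnd ℂ) (b - a) * (x - a)).im < 0 ∧ G x ≠ G a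
    · obtain ⟨x', hx', hxl', hxne⟩ := hxa
      exact h0 (eq_of_forall_sphere_inter_eq hG hd (isOpen_Ioi.preimage hlc) ⟨y, hy, hyl⟩
        fun z hz => (h.eq_or_eq_of_eq hDo hD hDb hWo hWc hDW hG hGg hGs ha1 hb1 hab hGab hx' hz.1
          hxl' hz.2).resolve_left hxne)
    · push Not at hxa
      exact h0 (eq_of_forall_sphere_inter_eq hG hd (isOpen_Iio.preimage hlc) ⟨x, hx, hxl⟩
        fun z hz => hxa z hz.1 hz.2)
  intro a ha b hb hab
  rw [← ball_union_sphere] at ha hb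
  rcases ha with ha | ha <;> rcases hb with hb | hb
  · rw [hGg ha, hGg hb] at hab
    rw [← h.left_inv a ha, hab, h.left_inv b hb]
  · exact absurd (hab ▸ hGb a ha) (hGs hb)
  · exact absurd (hab ▸ hGb b hb) (hGs ha)
  · exact hsph a ha b hb hab

theorem nonempty_homeomorph_closedBall {D W : Set ℂ} (hDo : IsOpen D) (hD : IsConnected D)
    (hDb : Bornology.IsBounded D) (hWo : IsOpen W) (hWc : IsPreconnected W)
    (hDW : Dᶜ = closure W) (hW : LocallyConnectedAtBoundary W) :
    Nonempty (closure D ≃ₜ closedBall (0 : ℂ) 1) := by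
  obtain ⟨f, g, h⟩ := exists_riemann_map hDo hD hDb (hDW ▸ hWc.closure)
  obtain ⟨G, hG, hGg, hGs⟩ :=
    h.exists_continuousOn_closedBall hDo hD.isPreconnected hDb hDW hW
  have hinj := h.injOn_closedBall hDo hD.isPreconnected hDb hWo hWc hDW hG hGg hGs
  have himg : G '' closedBall 0 1 = closure D := by
    have hb : G '' ball 0 1 = D := by
      rw [hGg.image_eq]
      exact h.mapsTo.image_subset.antisymm fun z hz => ⟨f z, h.mapsTo_inv hz, h.right_inv z hz⟩
    refine Subset.antisymm ?_ (closure_minimal ?_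
      ((isCompact_closedBall 0 1).image_of_continuousOn hG).isClosed)
    · rw [← closure_ball (0 : ℂ) one_ne_zero] at hG ⊢
      rw [← hb]
      exact hG.image_closure
    · rw [← hb]
      exact image_mono ball_subset_closedBall
  have hcont : Continuous (hinj.bijOn_image.equiv G) :=
    hG.domRestrict.subtype_mk _
  rw [← himg]
  exact ⟨hcont.homeoOfEquivCompactToT2.symm⟩

theorem nonempty_homeomorph_compl_connectedComponentIn {ι : Type*} [Finite ι] {V : ι → Set ℂ}
    (hV : ∀ i, ∃ H G, DiskParam (V i) H G) (hc : IsConnected (⋃ i, interior (V i))) {a : ℂ}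
    (ha : a ∈ (⋃ i, V i)ᶜ) (hW : ¬ Bornology.IsBounded (connectedComponentIn (⋃ i, V i)ᶜ a)) :
    Nonempty (((connectedComponentIn (⋃ i, V i)ᶜ a)ᶜ : Set ℂ) ≃ₜ closedBall (0 : ℂ) 1) := by
  have hVc : ∀ i, IsCompact (V i) := fun i => by
    obtain ⟨H, G, h⟩ := hV i
    exact h.isCompact
  have hUc : IsCompact (⋃ i, V i) := isCompact_iUnion hVc
  obtain ⟨R, hR⟩ := exists_compl_closedBall_subset hUc.isBounded hW
  have hcl := closure_interior_compl_connectedComponentIn hV a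
  have hloc := locallyConnectedAtBoundary_connectedComponentIn hV hc.isPreconnected a
  have hpre := isPreconnected_interior_compl hV hc ha
  have hWo := hUc.isClosed.isOpen_compl.connectedComponentIn (x := a)
  have hsub := connectedComponentIn_subset (⋃ i, V i)ᶜ a
  rw [← hcl]
  refine nonempty_homeomorph_closedBall isOpen_interior ⟨?_, hpre⟩ ?_ hWo
    isPreconnected_connectedComponentIn (by rw [interior_compl, compl_compl]) hloc
  · refine hc.nonempty.mono (interior_maximal ?_ (isOpen_iUnion fun i => isOpen_interior))
    rw [subset_compl_comm]
    exact hsub.trans (compl_subset_compl.2 (iUnion_mono fun i => interior_subset))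
  · exact isBounded_closedBall.subset (interior_subset.trans (compl_subset_comm.1 hR))

theorem stmt_0 (n : ℕ) (V : Fin n → Set Plane)
    (hclosed : ∀ i, IsClosed (V i))
    (hdisk : ∀ i, Nonempty ((V i) ≃ₜ (closedBall (0 : Plane) 1)))
    (hconn : IsConnected (⋃ i, interior (V i)))
    (W : Set Plane)
    (hWcomp : ∃ x ∈ (⋃ i, V i)ᶜ, W = connectedComponentIn (⋃ i, V i)ᶜ x)
    (hWunbounded : ¬ Bornology.IsBounded W) :
    Nonempty ((Wᶜ : Set Plane) ≃ₜ (closedBall (0 : Plane) 1)) := by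
  obtain ⟨x, hx, rfl⟩ := hWcomp
  let e : Plane ≃ᵢ ℂ := Complex.orthonormalBasisOneI.repr.symm.toIsometryEquiv
  have he0 : e 0 = 0 := map_zero Complex.orthonormalBasisOneI.repr.symm
  have hball : e '' closedBall 0 1 = closedBall 0 1 := by rw [e.image_closedBall, he0]
  let b : closedBall (0 : Plane) 1 ≃ₜ closedBall (0 : ℂ) 1 :=
    (e.toHomeomorph.image _).trans (Homeomorph.setCongr hball)
  have hV : ∀ i, ∃ H G, DiskParam (e '' V i) H G := fun i => by
    obtain ⟨d⟩ := hdisk i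
    exact exists_diskParam (e.toHomeomorph.isClosed_image.2 (hclosed i))
      ((e.toHomeomorph.image (V i)).symm.trans (d.trans b))
  have hU : (⋃ i, e '' V i)ᶜ = e '' (⋃ i, V i)ᶜ := by
    rw [← image_iUnion, image_compl_eq e.bijective]
  have h_int : ⋃ i, interior (e '' V i) = e '' ⋃ i, interior (V i) := by
    rw [image_iUnion]
    exact iUnion_congr fun i => (e.toHomeomorph.image_interior (V i)).symm
  have hcomp : connectedComponentIn (⋃ i, e '' V i)ᶜ (e x) =
      e '' connectedComponentIn (⋃ i, V i)ᶜ x := by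
    rw [hU]
    exact (e.toHomeomorph.image_connectedComponentIn hx).symm
  obtain ⟨k⟩ := nonempty_homeomorph_compl_connectedComponentIn hV
    (by rw [h_int]; exact hconn.image e e.continuous.continuousOn) (a := e x)
    (by rw [hU]; exact mem_image_of_mem e hx)
    (by
      rw [hcomp]
      intro h
      refine hWunbounded ?_
      have := e.symm.isometry.lipschitz.isBounded_image h
      rwa [← image_comp, e.symm_comp_self, image_id] at this)
  refine ⟨(e.toHomeomorph.image _).trans ((Homeomorph.setCongr ?_).trans (k.trans b.symm))⟩
  rw [hcomp, ← image_compl_eq e.bijective]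
  rfl
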